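/- arXiv:2404.17234 — 9 statements merged into one kernel-verified Lean document; each statement's English description precedes it below -/
import Mathlib

section
/- Let p be a prime and n, m ≥ 1. Let U ⊆ (Fin n → ℚ_p) be a nonempty open definable set and let f : (Fin n → ℚ_p) → (Fin m → ℚ_p) be a function whose graph over U is definable. Then there is a definable open set U₀ ⊆ U such that U \ U₀ is nowhere dense (its closure has empty interior) and f is strictly differentiable at every point a ∈ U₀: there is a continuous ℚ_p-linear map A : (Fin n → ℚ_p) → (Fin m → ℚ_p) such that ‖f y - f x - A (y - x)‖ / ‖y - x‖ → 0 as (x, y) → (a, a) with x, y ∈ U₀ and x ≠ y. -/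
open FirstOrder Filter Topology

/-- The ring-language structure on `ℚ_[p]`. -/
noncomputable instance (p : ℕ) [Fact p.Prime] : FirstOrder.Language.ring.Structure ℚ_[p] :=
  (FirstOrder.Ring.compatibleRingOfRing ℚ_[p]).toStructure

/-- `x` is a nonzero `N`-th power. -/
def IsPow {F : Type*} [Field F] (N : ℕ) (x : F) : Prop := ∃ y : F, y ≠ 0 ∧ y ^ N = x

namespace IsPow

variable {F : Type*} [Field F] {N M : ℕ} {x y : F}

theorem ne_zero (h : IsPow N x) : x ≠ 0 := by
  obtain ⟨y, hy, rfl⟩ := h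
  exact pow_ne_zero _ hy

theorem one_iff : IsPow 1 x ↔ x ≠ 0 :=
  ⟨ne_zero, fun h => ⟨x, h, pow_one x⟩⟩

theorem pow_self (hx : x ≠ 0) : IsPow N (x ^ N) := ⟨x, hx, rfl⟩

theorem mul (hx : IsPow N x) (hy : IsPow N y) : IsPow N (x * y) := by
  obtain ⟨a, ha, rfl⟩ := hx
  obtain ⟨b, hb, rfl⟩ := hy
  exact ⟨a * b, mul_ne_zero ha hb, mul_pow a b N⟩

theorem inv (hx : IsPow N x) : IsPow N x⁻¹ := by
  obtain ⟨a, ha, rfl⟩ := hx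
  exact ⟨a⁻¹, inv_ne_zero ha, inv_pow a N⟩

theorem mul_iff_left (hx : IsPow N x) : IsPow N (x * y) ↔ IsPow N y := by
  refine ⟨fun h => ?_, hx.mul⟩
  have := hx.inv.mul h
  rwa [inv_mul_cancel_left₀ hx.ne_zero] at this

theorem mul_iff_right (hx : IsPow N x) : IsPow N (y * x) ↔ IsPow N y := by
  rw [mul_comm, hx.mul_iff_left]

theorem pow (hx : IsPow N x) (i : ℕ) : IsPow N (x ^ i) := by
  obtain ⟨a, ha, rfl⟩ := hx
  exact ⟨a ^ i, pow_ne_zero _ ha, pow_right_comm a i N⟩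

theorem of_dvd (hx : IsPow M x) (h : N ∣ M) : IsPow N x := by
  obtain ⟨k, rfl⟩ := h
  obtain ⟨a, ha, rfl⟩ := hx
  exact ⟨a ^ k, pow_ne_zero _ ha, by rw [← pow_mul, mul_comm]⟩

end IsPow

/-- The properties of a nonstandard extension `E` of a `p`-adically closed field `k`, with the
valuation `v` obtained by coarsening the nonstandard valuation so that it is trivial on `k`, that
are used in the proof of quantifier elimination. -/
structure CoarseHenselian (k : Type*) {E Γ₀ : Type*} [Field k] [Field E] [Algebra k E]
    [LinearOrderedCommGroupWithZero Γ₀] (v : Valuation E Γ₀) : Prop where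
  map_const : ∀ c : k, c ≠ 0 → v (algebraMap k E c) = 1
  surj : Function.Surjective v
  exists_residue : ∀ x, v x ≤ 1 → ∃ c : k, v (x - algebraMap k E c) < 1
  hensel : ∀ (d : ℕ) (e : ℕ → E), v (e 0) ≤ 1 → e 1 = 1 → (∀ i ≥ 2, v (e i) < 1) →
    ∃ u, v u ≤ 1 ∧ ∑ i ∈ Finset.range (d + 2), e i * u ^ i = 0
  isPow_one_add : ∀ N > 0, ∀ z, v z < 1 → IsPow N (1 + z)
  exists_isPow_mul : ∀ N > 0, ∀ x : E, x ≠ 0 → ∃ c : k, c ≠ 0 ∧ IsPow N (algebraMap k E c * x)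
  exists_pow_eq : ∀ N > 0, ∀ e : E, ∃ z, v z ^ N = v e
  le_one_iff : ∃ c : ℕ → k, ∀ x : E, v x ≤ 1 ↔ ∃ n, IsPow 2 (1 + algebraMap k E (c n) * x ^ 2)

namespace CoarseHenselian

open Polynomial

variable {k E Γ₀ : Type*} [Field k] [Field E] [Algebra k E]
  [LinearOrderedCommGroupWithZero Γ₀] {v : Valuation E Γ₀}

theorem isPow_congr (H : CoarseHenselian k v) {N : ℕ} (hN : 0 < N) {x y : E}
    (h : v (x - y) < v y) : IsPow N x ↔ IsPow N y := by
  have hy : y ≠ 0 := by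
    rintro rfl
    simp at h
  have h1 : IsPow N (1 + (x - y) / y) := by
    refine H.isPow_one_add N hN _ ?_
    rw [map_div₀]
    exact (div_lt_one₀ (v.pos_iff.2 hy)).2 h
  have h2 : x = y * (1 + (x - y) / y) := by field_simp; ring
  rw [h2, h1.mul_iff_right]

theorem map_natCast_eq_one [CharZero k] (H : CoarseHenselian k v) {n : ℕ} (hn : n ≠ 0) :
    v (n : E) = 1 := by
  have := H.map_const n (by exact_mod_cast hn)
  simpa using this

theorem map_natCast_le_one [CharZero k] (H : CoarseHenselian k v) (n : ℕ) : v (n : E) ≤ 1 := by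
  by_cases hn : n = 0
  · simp [hn]
  · exact (H.map_natCast_eq_one hn).le

end CoarseHenselian

section Valuation

open Polynomial

variable {E Γ₀ : Type*} [Field E] [LinearOrderedCommGroupWithZero Γ₀] (v : Valuation E Γ₀)

theorem Valuation.eval_sub_lt (P : E[X]) (s : E) (j : ℕ) (hj : P.coeff j * s ^ j ≠ 0)
    (h : ∀ i, i ≠ j → v (P.coeff i * s ^ i) < v (P.coeff j * s ^ j)) :
    v (P.eval s - P.coeff j * s ^ j) < v (P.coeff j * s ^ j) := by
  have hjP : j ∈ Finset.range (P.natDegree + 1) := by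
    rw [Finset.mem_range, Nat.lt_succ_iff]
    exact le_natDegree_of_ne_zero (left_ne_zero_of_mul hj)
  rw [eval_eq_sum_range, ← Finset.sum_erase_add _ _ hjP, add_sub_cancel_right]
  refine v.map_sum_lt (by simpa using hj) fun i hi => h i (Finset.ne_of_mem_erase hi)

theorem Valuation.root_unique (T : E[X]) (a : E) (ha : a ≠ 0) (h1 : T.coeff 1 ≠ 0)
    (h2 : ∀ i ≥ 2, v (T.coeff i) * v a ^ i < v (T.coeff 1) * v a) {u w : E} (hu : v u ≤ v a)
    (hw : v w ≤ v a) (hTu : T.eval u = 0) (hTw : T.eval w = 0) : u = w := by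
  by_contra hne
  have hva : 0 < v a := v.pos_iff.2 ha
  have hpos : 0 < v (u - w) := v.pos_iff.2 (sub_ne_zero.2 hne)
  have hle : ∀ i, v (u ^ i - w ^ i) * v a ≤ v a ^ i * v (u - w) := fun i => by
    rcases Nat.eq_zero_or_pos i with rfl | hi
    · simp
    rw [← (Commute.all u w).mul_geom_sum₂, mul_comm (v a ^ i), map_mul, mul_assoc]
    gcongr
    have : v a ^ i = v a ^ (i - 1) * v a := by rw [← pow_succ, Nat.sub_add_cancel hi]
    rw [this]
    gcongr
    refine v.map_sum_le fun j hj => ?_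
    rw [Finset.mem_range] at hj
    have e : i - 1 = j + (i - 1 - j) := by omega
    conv_rhs => rw [e, pow_add]
    rw [map_mul, map_pow, map_pow]
    gcongr
  have hsum : ∑ i ∈ Finset.range (T.natDegree + 1), T.coeff i * (u ^ i - w ^ i) = 0 := by
    simp_rw [mul_sub, Finset.sum_sub_distrib, ← eval_eq_sum_range, hTu, hTw, sub_zero]
  have h1m : 1 ∈ Finset.range (T.natDegree + 1) := by
    rw [Finset.mem_range, Nat.lt_succ_iff]
    exact le_natDegree_of_ne_zero h1
  rw [← Finset.sum_erase_add _ _ h1m, pow_one, pow_one] at hsum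
  have hlt : v (∑ i ∈ (Finset.range (T.natDegree + 1)).erase 1, T.coeff i * (u ^ i - w ^ i))
      < v (T.coeff 1 * (u - w)) := by
    have hne1 : v (T.coeff 1 * (u - w)) ≠ 0 := by
      simpa [sub_eq_zero] using ⟨h1, hne⟩
    refine v.map_sum_lt hne1 fun i hi => ?_
    rcases i with _ | _ | i
    · simpa using! zero_lt_iff.2 hne1
    · simp at hi
    rw [map_mul, map_mul, ← mul_lt_mul_iff_left₀ hva]
    calc v (T.coeff (i + 2)) * v (u ^ (i + 2) - w ^ (i + 2)) * v a
        ≤ v (T.coeff (i + 2)) * (v a ^ (i + 2) * v (u - w)) := by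
          rw [mul_assoc]
          exact mul_le_mul_right (hle _) _
      _ < v (T.coeff 1) * v (u - w) * v a := by
          rw [← mul_assoc, mul_right_comm (v (T.coeff 1))]
          exact mul_lt_mul_of_pos_right (h2 (i + 2) (by omega)) hpos
  rw [eq_neg_of_add_eq_zero_left hsum, v.map_neg] at hlt
  exact lt_irrefl _ hlt

end Valuation

namespace CoarseHenselian

open Polynomial

variable {k E Γ₀ : Type*} [Field k] [Field E] [Algebra k E]
  [LinearOrderedCommGroupWithZero Γ₀] {v : Valuation E Γ₀}

theorem taylor_coeff_lt [CharZero k] (H : CoarseHenselian k v) (T : E[X]) (a : E) (j : ℕ)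
    {B : Γ₀} (hB : 0 < B) (h : ∀ i ≥ j, v (T.coeff i) * v a ^ i < B) :
    v ((taylor a T).coeff j) * v a ^ j < B := by
  rw [taylor_coeff, eval_eq_sum_range, ← map_pow, ← map_mul, Finset.sum_mul]
  refine v.map_sum_lt hB.ne' fun i _ => ?_
  rw [hasseDeriv_coeff, mul_assoc, ← pow_add, map_mul, map_mul, map_pow, mul_assoc]
  exact (mul_le_of_le_one_left' (H.map_natCast_le_one _)).trans_lt (h (i + j) (by omega))

/-- Hensel's lemma for a polynomial whose linear term dominates on the ball of radius `v a`. -/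
theorem exists_root (H : CoarseHenselian k v) (T : E[X]) (a : E) (ha : a ≠ 0)
    (h1 : T.coeff 1 ≠ 0) (h0 : v (T.coeff 0) ≤ v (T.coeff 1) * v a)
    (h2 : ∀ i ≥ 2, v (T.coeff i) * v a ^ i < v (T.coeff 1) * v a) :
    ∃ u, v u ≤ v a ∧ T.eval u = 0 := by
  have hc : T.coeff 1 * a ≠ 0 := mul_ne_zero h1 ha
  have hvc : 0 < v (T.coeff 1 * a) := v.pos_iff.2 hc
  obtain ⟨u, hu, he⟩ := H.hensel (T.natDegree - 1) (fun i => T.coeff i * a ^ i / (T.coeff 1 * a))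
    (by simpa using div_le_one_of_le₀ h0 zero_le) (by simp [div_self hc]) (fun i hi => by
      rw [map_div₀, div_lt_one₀ hvc]
      simpa using h2 i hi)
  refine ⟨a * u, by simpa using mul_le_of_le_one_right' hu, ?_⟩
  have hd : T.natDegree - 1 + 2 = T.natDegree + 1 := by
    have := le_natDegree_of_ne_zero h1
    omega
  rw [hd] at he
  rw [eval_eq_sum_range]
  have : ∀ i, T.coeff i * (a * u) ^ i
      = T.coeff 1 * a * (T.coeff i * a ^ i / (T.coeff 1 * a) * u ^ i) := fun i => by
    rw [mul_pow, ← mul_assoc, ← mul_assoc, mul_div_cancel₀ _ hc]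
  simp_rw [this, ← Finset.mul_sum, he, mul_zero]

end CoarseHenselian

section Pairs

open Polynomial

variable {k E Γ₀ : Type*} [Field k] [Field E] [Algebra k E]
  [LinearOrderedCommGroupWithZero Γ₀] {v : Valuation E Γ₀}

/-- A subalgebra of `E × E` matches if it is the graph of a partial isomorphism of `E` preserving
the `N`-th powers for all `N`. -/
def Matches (G : Subalgebra k (E × E)) : Prop :=
  ∀ g ∈ G, ∀ N > 0, IsPow N g.1 ↔ IsPow N g.2

/-- The first projection of a subalgebra of `E × E`. -/
def fstHom (G : Subalgebra k (E × E)) : G →+* E := (RingHom.fst E E).comp G.val.toRingHom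

/-- The second projection of a subalgebra of `E × E`. -/
def sndHom (G : Subalgebra k (E × E)) : G →+* E := (RingHom.snd E E).comp G.val.toRingHom

theorem exists_maximal_matches {G₀ : Subalgebra k (E × E)} (h : Matches G₀) :
    ∃ G, G₀ ≤ G ∧ Maximal Matches G := by
  refine zorn_le_nonempty₀ {G | Matches G} (fun c hc hchain y hy => ?_) G₀ h
  have : Nonempty c := ⟨⟨y, hy⟩⟩
  have hdir : Directed (· ≤ ·) (fun G : c => (G : Subalgebra k (E × E))) := hchain.directed
  refine ⟨⨆ G : c, (G : Subalgebra k (E × E)), fun g hg => ?_, fun z hz =>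
    le_iSup (fun G : c => (G : Subalgebra k (E × E))) ⟨z, hz⟩⟩
  rw [← SetLike.mem_coe, Subalgebra.coe_iSup_of_directed hdir, Set.mem_iUnion] at hg
  obtain ⟨i, hi⟩ := hg
  exact hc i.2 g hi

variable {G : Subalgebra k (E × E)}

theorem Matches.of_adjoin {t t' : E}
    (h : ∀ f : G[X], ∀ N > 0,
      IsPow N ((f.map (fstHom G)).eval t) ↔ IsPow N ((f.map (sndHom G)).eval t')) :
    Matches ((Algebra.adjoin G {(t, t')}).restrictScalars k) := by
  intro g hg N hN
  have hg' : g ∈ Algebra.adjoin G {(t, t')} := hg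
  rw [Algebra.adjoin_singleton_eq_range_aeval] at hg'
  obtain ⟨f, rfl⟩ := (AlgHom.mem_range _).1 hg'
  have e1 : (aeval (t, t') f).1 = (f.map (fstHom G)).eval t := by
    rw [eval_map, aeval_def]
    exact hom_eval₂ f _ (RingHom.fst E E) (t, t')
  have e2 : (aeval (t, t') f).2 = (f.map (sndHom G)).eval t' := by
    rw [eval_map, aeval_def]
    exact hom_eval₂ f _ (RingHom.snd E E) (t, t')
  rw [e1, e2]
  exact h f N hN

theorem Maximal.mk_mem (hG : Maximal Matches G) {t t' : E}
    (h : ∀ f : G[X], ∀ N > 0,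
      IsPow N ((f.map (fstHom G)).eval t) ↔ IsPow N ((f.map (sndHom G)).eval t')) :
    (t, t') ∈ G := by
  have hle : G ≤ (Algebra.adjoin G {(t, t')}).restrictScalars k := fun g hg =>
    (Algebra.adjoin G {(t, t')}).algebraMap_mem ⟨g, hg⟩
  have hmem : (t, t') ∈ Algebra.adjoin G {(t, t')} := Algebra.subset_adjoin rfl
  exact hG.2 (Matches.of_adjoin h) hle hmem

theorem Maximal.mk_mem_of_monic (hG : Maximal Matches G) {t t' : E} {q : G[X]} (hq : q.Monic)
    (ht : (q.map (fstHom G)).eval t = 0) (ht' : (q.map (sndHom G)).eval t' = 0)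
    (h : ∀ f : G[X], f ≠ 0 → f.degree < q.degree → ∀ N > 0,
      IsPow N ((f.map (fstHom G)).eval t) ↔ IsPow N ((f.map (sndHom G)).eval t')) :
    (t, t') ∈ G := by
  refine hG.mk_mem fun f N hN => ?_
  nontriviality G
  have e := modByMonic_add_div f q
  have e1 : (f.map (fstHom G)).eval t = ((f %ₘ q).map (fstHom G)).eval t := by
    conv_lhs => rw [← e]
    rw [Polynomial.map_add, Polynomial.map_mul, eval_add, eval_mul, ht, zero_mul, add_zero]
  have e2 : (f.map (sndHom G)).eval t' = ((f %ₘ q).map (sndHom G)).eval t' := by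
    conv_lhs => rw [← e]
    rw [Polynomial.map_add, Polynomial.map_mul, eval_add, eval_mul, ht', zero_mul, add_zero]
  rw [e1, e2]
  by_cases h0 : f %ₘ q = 0
  · rw [h0]
    simp only [Polynomial.map_zero, eval_zero]
  · exact h _ h0 (degree_modByMonic_lt f hq) N hN

theorem Matches.isPow_iff (hG : Matches G) (g : G) {N : ℕ} (hN : 0 < N) :
    IsPow N (fstHom G g) ↔ IsPow N (sndHom G g) := hG g g.2 N hN

theorem Matches.fst_eq_zero_iff (hG : Matches G) (g : G) :
    fstHom G g = 0 ↔ sndHom G g = 0 := by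
  have := hG.isPow_iff g one_pos
  rwa [IsPow.one_iff, IsPow.one_iff, not_iff_not] at this

theorem Matches.fst_injective (hG : Matches G) : Function.Injective (fstHom G) := by
  rw [injective_iff_map_eq_zero]
  intro g hg
  exact Subtype.ext (Prod.ext hg ((hG.fst_eq_zero_iff g).1 hg))

theorem Matches.snd_injective (hG : Matches G) : Function.Injective (sndHom G) := by
  rw [injective_iff_map_eq_zero]
  intro g hg
  exact Subtype.ext (Prod.ext ((hG.fst_eq_zero_iff g).2 hg) hg)

theorem Maximal.exists_inv (hG : Maximal Matches G) {g : G} (hg : g ≠ 0) : ∃ h : G, g * h = 1 := by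
  have h1 : fstHom G g ≠ 0 := fun h => hg (hG.prop.fst_injective (by simpa using h))
  have h2 : sndHom G g ≠ 0 := fun h => hg (hG.prop.snd_injective (by simpa using h))
  suffices hm : ((fstHom G g)⁻¹, (sndHom G g)⁻¹) ∈ G from
    ⟨⟨_, hm⟩, Subtype.ext (Prod.ext (mul_inv_cancel₀ h1) (mul_inv_cancel₀ h2))⟩
  refine hG.mk_mem fun f N hN => ?_
  have key : ∀ φ : G →+* E, φ g ≠ 0 → (IsPow N ((f.map φ).eval (φ g)⁻¹) ↔
      IsPow N (φ (f.reverse.eval g * g ^ ((N - 1) * f.natDegree)))) := fun φ h => by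
    have e : (f.map φ).eval (φ g)⁻¹ * φ g ^ f.natDegree = φ (f.reverse.eval g) := by
      let := invertibleOfNonzero (inv_ne_zero h)
      have e := eval₂_reverse_mul_pow φ (φ g)⁻¹ f
      rw [invOf_eq_inv, inv_inv, eval₂_at_apply] at e
      rw [eval_map, ← e, mul_assoc, ← mul_pow, inv_mul_cancel₀ h, one_pow, mul_one]
    rw [map_mul, ← e, map_pow, mul_assoc, ← pow_add, IsPow.mul_iff_right]
    have : f.natDegree + (N - 1) * f.natDegree = f.natDegree * N := by
      obtain ⟨N, rfl⟩ := Nat.exists_eq_succ_of_ne_zero hN.ne'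
      simp
      ring
    rw [this, pow_mul]
    exact IsPow.pow_self (pow_ne_zero _ h)
  rw [key _ h1, key _ h2]
  exact hG.prop.isPow_iff _ hN

theorem Matches.val_le_one_iff (H : CoarseHenselian k v) (hG : Matches G) (g : G) :
    v (fstHom G g) ≤ 1 ↔ v (sndHom G g) ≤ 1 := by
  obtain ⟨c, hc⟩ := H.le_one_iff
  rw [hc, hc]
  refine exists_congr fun n => ?_
  exact hG.isPow_iff (1 + algebraMap k G (c n) * g ^ 2) two_pos

theorem Maximal.val_le_iff (H : CoarseHenselian k v) (hG : Maximal Matches G) (g h : G) :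
    v (fstHom G g) ≤ v (fstHom G h) ↔ v (sndHom G g) ≤ v (sndHom G h) := by
  by_cases h0 : h = 0
  · simp [h0, hG.prop.fst_eq_zero_iff]
  obtain ⟨i, hi⟩ := hG.exists_inv h0
  have key : ∀ φ : G →+* E, v (φ g) ≤ v (φ h) ↔ v (φ (g * i)) ≤ 1 := fun φ => by
    have h1 : φ h * φ i = 1 := by rw [← map_mul, hi, map_one]
    have h2 : v (φ h) * v (φ i) = 1 := by rw [← map_mul, h1, map_one]
    have h3 : 0 < v (φ i) := v.pos_iff.2 (right_ne_zero_of_mul_eq_one h1)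
    rw [map_mul, map_mul, ← h2, mul_le_mul_iff_left₀ h3]
  rw [key, key]
  exact hG.prop.val_le_one_iff H _

theorem Maximal.val_lt_iff (H : CoarseHenselian k v) (hG : Maximal Matches G) (g h : G) :
    v (fstHom G g) < v (fstHom G h) ↔ v (sndHom G g) < v (sndHom G h) := by
  rw [← not_le, ← not_le, hG.val_le_iff H]

end Pairs

section Values

open Polynomial

variable {k E Γ₀ : Type*} [Field k] [Field E] [Algebra k E]
  [LinearOrderedCommGroupWithZero Γ₀] {v : Valuation E Γ₀} {G : Subalgebra k (E × E)}

/-- The value of `x` is the value of the first component of an element of `G`. -/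
def IsVal (v : Valuation E Γ₀) (G : Subalgebra k (E × E)) (x : E) : Prop :=
  ∃ g : G, v (fstHom G g) = v x

theorem CoarseHenselian.isPow_eval_iff (H : CoarseHenselian k v) {P : E[X]} {s : E} {j : ℕ}
    (hj : P.coeff j * s ^ j ≠ 0)
    (h : ∀ i, i ≠ j → v (P.coeff i * s ^ i) < v (P.coeff j * s ^ j)) {N : ℕ} (hN : 0 < N) :
    IsPow N (P.eval s) ↔ IsPow N (P.coeff j * s ^ j) :=
  H.isPow_congr hN (v.eval_sub_lt P s j hj h)

theorem fstHom_algebraMap (c : k) : fstHom G (algebraMap k G c) = algebraMap k E c := rfl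

theorem sndHom_algebraMap (c : k) : sndHom G (algebraMap k G c) = algebraMap k E c := rfl

theorem Matches.isPow_mul_pow_iff (hG : Matches G) {M : ℕ} (hM : 0 < M) {s s' : E} {c : k}
    (hc : c ≠ 0) (hs : IsPow M (algebraMap k E c * s)) (hs' : IsPow M (algebraMap k E c * s'))
    (g : G) (j : ℕ) : IsPow M (fstHom G g * s ^ j) ↔ IsPow M (sndHom G g * s' ^ j) := by
  have hc' : algebraMap k E c ≠ 0 := by simpa using hc
  have key : ∀ a x : E, a * x ^ j = algebraMap k E (c⁻¹) ^ j * a * (algebraMap k E c * x) ^ j :=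
    fun a x => by
      rw [map_inv₀, mul_pow, inv_pow]
      field_simp
  rw [key, key (sndHom G g), (hs.pow j).mul_iff_right, (hs'.pow j).mul_iff_right]
  simpa [fstHom_algebraMap, sndHom_algebraMap] using
    hG.isPow_iff (algebraMap k G (c⁻¹) ^ j * g) hM

theorem Maximal.isVal_div (hG : Maximal Matches G) {x y : E} (hx : IsVal v G x)
    (hy : IsVal v G y) : IsVal v G (x / y) := by
  obtain ⟨g, hg⟩ := hx
  obtain ⟨h, hh⟩ := hy
  by_cases h0 : h = 0
  · subst h0
    have : y = 0 := by simpa using hh.symm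
    exact ⟨0, by simp [this]⟩
  obtain ⟨i, hi⟩ := hG.exists_inv h0
  have h1 : fstHom G h * fstHom G i = 1 := by rw [← map_mul, hi, map_one]
  refine ⟨g * i, ?_⟩
  rw [map_mul, map_mul, hg, eq_inv_of_mul_eq_one_right h1, map_inv₀, hh, map_div₀, div_eq_mul_inv]

theorem IsVal.of_mul_pow_eq (hG : Maximal Matches G) {a b : G} {s : E} {i j : ℕ} (hij : i < j)
    (hb : b ≠ 0) (hs : s ≠ 0)
    (h : v (fstHom G a * s ^ i) = v (fstHom G b * s ^ j)) : IsVal v G (s ^ (j - i)) := by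
  have hb' : v (fstHom G b) ≠ 0 := by
    simpa using (map_ne_zero_iff _ hG.prop.fst_injective).2 hb
  have hs' : v s ^ i ≠ 0 := by simpa using fun h => (hs h).elim
  obtain ⟨g, hg⟩ := hG.isVal_div (v := v) (x := fstHom G a) (y := fstHom G b) ⟨a, rfl⟩ ⟨b, rfl⟩
  refine ⟨g, ?_⟩
  rw [hg, map_div₀, map_pow, div_eq_iff hb']
  have e : v s ^ j = v s ^ (j - i) * v s ^ i := by rw [← pow_add, Nat.sub_add_cancel hij.le]
  rw [map_mul, map_mul, map_pow, map_pow, e, ← mul_assoc] at h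
  rw [mul_right_cancel₀ hs' h, mul_comm]

/-- If no small power of `s` has a value in `G`, one term of `f (s)` dominates. -/
theorem Maximal.exists_dominant (hG : Maximal Matches G) {s : E} {D : ℕ}
    (hs : ∀ m, 0 < m → m < D → ¬ IsVal v G (s ^ m)) (hs0 : s ≠ 0) {f : G[X]} (hf : f ≠ 0)
    (hD : f.natDegree < D) :
    ∃ j, f.coeff j ≠ 0 ∧ ∀ i, i ≠ j →
      v (fstHom G (f.coeff i) * s ^ i) < v (fstHom G (f.coeff j) * s ^ j) := by
  obtain ⟨j, hj, hmax⟩ := f.support.exists_max_image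
    (fun i => v (fstHom G (f.coeff i) * s ^ i)) (support_nonempty.2 hf)
  have hj' := mem_support_iff.1 hj
  refine ⟨j, hj', fun i hij => ?_⟩
  by_cases hi : f.coeff i = 0
  · rw [hi, map_zero, zero_mul, map_zero, v.pos_iff]
    exact mul_ne_zero ((map_ne_zero_iff _ hG.prop.fst_injective).2 hj') (pow_ne_zero _ hs0)
  refine (hmax i (mem_support_iff.2 hi)).lt_of_ne fun he => ?_
  have hiD := (le_natDegree_of_ne_zero hi).trans_lt hD
  have hjD := (le_natDegree_of_ne_zero hj').trans_lt hD
  rcases hij.lt_or_gt with h | h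
  · exact hs (j - i) (by omega) (by omega) (IsVal.of_mul_pow_eq hG h hj' hs0 he)
  · exact hs (i - j) (by omega) (by omega) (IsVal.of_mul_pow_eq hG h hi hs0 he.symm)

theorem Maximal.exists_nearer (H : CoarseHenselian k v) {t : E} {g : G}
    (ht : t ≠ fstHom G g) (hv : IsVal v G (t - fstHom G g)) :
    ∃ g₂, v (t - fstHom G g₂) < v (t - fstHom G g) := by
  obtain ⟨h, hh⟩ := hv
  have hpos : 0 < v (fstHom G h) := hh ▸ v.pos_iff.2 (sub_ne_zero.2 ht)
  have h0 : fstHom G h ≠ 0 := v.pos_iff.1 hpos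
  obtain ⟨c, hc⟩ := H.exists_residue ((t - fstHom G g) / fstHom G h) (by
    rw [map_div₀, hh]
    exact div_self_le_one _)
  refine ⟨g + algebraMap k G c * h, ?_⟩
  have e : t - fstHom G (g + algebraMap k G c * h)
      = fstHom G h * ((t - fstHom G g) / fstHom G h - algebraMap k E c) := by
    rw [map_add, map_mul, fstHom_algebraMap]
    field_simp
    ring
  rw [e, map_mul, ← hh]
  exact mul_lt_of_lt_one_right hpos hc

theorem CoarseHenselian.exists_pow_eq_mul (H : CoarseHenselian k v) {N : ℕ} (hN : 0 < N) {s g : E}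
    (hs : s ≠ 0) (h : v g = v (s ^ N)) :
    ∃ c : k, ∃ s₁ : E, v s₁ = v s ∧ s₁ ^ N = algebraMap k E c * g := by
  have hsN : v (s ^ N) ≠ 0 := by simpa using fun h => (hs h).elim
  have hg : g ≠ 0 := by
    rintro rfl
    exact hsN (by rw [← h, map_zero])
  have hq : v (s ^ N / g) = 1 := by rw [map_div₀, h, div_self hsN]
  obtain ⟨c, hc⟩ := H.exists_residue (s ^ N / g) hq.le
  have hvc : v (algebraMap k E c) = 1 := by
    rw [← hq] at hc ⊢
    exact v.map_eq_of_sub_lt (by rwa [v.map_sub_swap])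
  have hc0 : algebraMap k E c ≠ 0 := by
    intro h0
    simp [h0] at hvc
  have hd : v (s ^ N - algebraMap k E c * g) < v (algebraMap k E c * g) := by
    have e : s ^ N - algebraMap k E c * g = (s ^ N / g - algebraMap k E c) * g := by
      field_simp
    rw [e, map_mul, map_mul, hvc]
    exact mul_lt_mul_of_pos_right hc (v.pos_iff.2 hg)
  obtain ⟨y, hy0, hy⟩ := H.isPow_one_add N hN ((s ^ N - algebraMap k E c * g) /
    (algebraMap k E c * g)) (by
      rw [map_div₀]
      exact (div_lt_one₀ (v.pos_iff.2 (mul_ne_zero hc0 hg))).2 hd)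
  have hy' : y ^ N * (algebraMap k E c * g) = s ^ N := by
    rw [hy]
    field_simp
    ring
  refine ⟨c, s / y, ?_, ?_⟩
  · have : v y = 1 := by
      have h1 := congrArg v hy'
      rw [map_mul, map_mul, hvc, one_mul, h, map_pow] at h1
      exact (pow_eq_one_iff_of_nonneg zero_le hN.ne').1
          (mul_right_cancel₀ hsN (by rw [h1, one_mul]))
    rw [map_div₀, this, div_one]
  · rw [div_pow, ← hy', mul_div_cancel_left₀ _ (pow_ne_zero _ hy0)]

/-- A root of `X ^ N - a` transfers to the other side together with its power classes. -/
theorem Matches.exists_pow_eq (H : CoarseHenselian k v) (hG : Matches G) {N : ℕ} (hN : 0 < N)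
    {a : G} {s : E} (hs : s ≠ 0) (ha : s ^ N = fstHom G a) :
    ∃ s' : E, s' ^ N = sndHom G a ∧ ∀ M > 0, ∃ c : k, c ≠ 0 ∧
      IsPow M (algebraMap k E c * s) ∧ IsPow M (algebraMap k E c * s') := by
  classical
  have h1 : ∀ M > 0, ∃ s' : E, s' ^ N = sndHom G a ∧ ∃ c : k, c ≠ 0 ∧
      IsPow M (algebraMap k E c * s) ∧ IsPow M (algebraMap k E c * s') := by
    intro M hM
    obtain ⟨c, hc, hp⟩ := H.exists_isPow_mul M hM s hs
    have hc' : algebraMap k E c ≠ 0 := by simpa using hc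
    have h2 : IsPow (M * N) (fstHom G (algebraMap k G c ^ N * a)) := by
      obtain ⟨y, hy, hys⟩ := hp
      refine ⟨y, hy, ?_⟩
      rw [pow_mul, hys, mul_pow, ha, map_mul, map_pow, fstHom_algebraMap]
    rw [hG.isPow_iff _ (Nat.mul_pos hM hN)] at h2
    obtain ⟨w, hw, hwa⟩ := h2
    rw [map_mul, map_pow, sndHom_algebraMap] at hwa
    refine ⟨w ^ M / algebraMap k E c, ?_, c, hc, hp, ?_⟩
    · rw [div_pow, ← pow_mul, hwa, mul_div_cancel_left₀ _ (pow_ne_zero _ hc')]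
    · rw [mul_div_cancel₀ _ hc']
      exact IsPow.pow_self hw
  by_contra hcon
  push Not at hcon
  choose! M hM hMc using hcon
  let R := (nthRoots N (sndHom G a)).toFinset
  have hR : ∀ s', s' ∈ R ↔ s' ^ N = sndHom G a := fun s' => by
    rw [Multiset.mem_toFinset, mem_nthRoots hN]
  obtain ⟨s', hs', c, hc, hp, hp'⟩ := h1 (∏ r ∈ R, M r)
    (Finset.prod_pos fun r hr => hM r ((hR r).1 hr))
  have hd : M s' ∣ ∏ r ∈ R, M r := Finset.dvd_prod_of_mem M ((hR s').2 hs')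
  exact hMc s' hs' c hc (hp.of_dvd hd) (hp'.of_dvd hd)

theorem Maximal.isVal_of_pow (H : CoarseHenselian k v) (hG : Maximal Matches G) {s : E}
    (h : ∃ N > 0, IsVal v G (s ^ N)) : IsVal v G s := by
  classical
  by_cases hs : s = 0
  · exact ⟨0, by simp [hs]⟩
  obtain ⟨hN, hv⟩ := Nat.find_spec h
  have hmin := fun m => Nat.find_min (m := m) h
  generalize Nat.find h = N at hN hv hmin
  obtain ⟨g, hg⟩ := hv
  obtain ⟨c, s₁, hs₁, hsN⟩ := H.exists_pow_eq_mul hN hs hg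
  have hs₁0 : s₁ ≠ 0 := v.pos_iff.1 (hs₁ ▸ v.pos_iff.2 hs)
  rw [← fstHom_algebraMap (G := G), ← map_mul] at hsN
  generalize algebraMap k G c * g = a at hsN
  obtain ⟨s', hs'N, hclass⟩ := hG.prop.exists_pow_eq H hN hs₁0 hsN
  suffices hm : (s₁, s') ∈ G from ⟨⟨_, hm⟩, hs₁⟩
  nontriviality G
  refine hG.mk_mem_of_monic (q := X ^ N - C a) (monic_X_pow_sub_C a hN.ne') (by simp [hsN])
    (by simp [hs'N]) fun f hf hfd M hM => ?_
  rw [degree_X_pow_sub_C hN, ← natDegree_lt_iff_degree_lt hf] at hfd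
  obtain ⟨j, hj, hdom⟩ := hG.exists_dominant (v := v) (s := s₁) (D := N) (fun m h0 hm hval => by
    refine hmin m hm ⟨h0, ?_⟩
    rwa [IsVal, map_pow, hs₁, ← map_pow] at hval) hs₁0 hf hfd
  have hs'0 : s' ≠ 0 := by
    rintro rfl
    have : fstHom G a = 0 := by
      rw [hG.prop.fst_eq_zero_iff, ← hs'N, zero_pow hN.ne']
    rw [← hsN] at this
    exact pow_ne_zero _ hs₁0 this
  have hdom' : ∀ i, i ≠ j →
      v (sndHom G (f.coeff i) * s' ^ i) < v (sndHom G (f.coeff j) * s' ^ j) := fun i hij => by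
    have h1 := pow_lt_pow_left₀ (hdom i hij) zero_le hN.ne'
    rw [← map_pow, ← map_pow, mul_pow, mul_pow, pow_right_comm s₁, pow_right_comm s₁ j, hsN,
      ← map_pow, ← map_pow, ← map_pow, ← map_pow, ← map_mul, ← map_mul, hG.val_lt_iff H] at h1
    refine lt_of_pow_lt_pow_left₀ N zero_le ?_
    rw [← map_pow, ← map_pow, mul_pow, mul_pow, pow_right_comm s', pow_right_comm s' j, hs'N]
    simpa using h1
  obtain ⟨c, hc, hp, hp'⟩ := hclass M hM
  rw [H.isPow_eval_iff (j := j) _ _ hM, H.isPow_eval_iff (j := j) _ _ hM, coeff_map, coeff_map]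
  · exact hG.prop.isPow_mul_pow_iff hM hc hp hp' _ _
  · rw [coeff_map]
    exact mul_ne_zero ((map_ne_zero_iff _ hG.prop.snd_injective).2 hj) (pow_ne_zero _ hs'0)
  · simpa only [coeff_map] using hdom'
  · rw [coeff_map]
    exact mul_ne_zero ((map_ne_zero_iff _ hG.prop.fst_injective).2 hj) (pow_ne_zero _ hs₁0)
  · simpa only [coeff_map] using hdom

end Values

section Near

open Polynomial

theorem Polynomial.taylor_derivative_coeff {R : Type*} [CommRing R] (t : R) (f : R[X]) (i : ℕ) :
    (taylor t (derivative f)).coeff i = (taylor t f).coeff (i + 1) * (i + 1) := by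
  have : taylor t (derivative f) = derivative (taylor t f) := by
    simp [taylor_apply, derivative_comp]
  rw [this, coeff_derivative]

variable {k E Γ₀ : Type*} [Field k] [Field E] [Algebra k E]
  [LinearOrderedCommGroupWithZero Γ₀] {v : Valuation E Γ₀} {G : Subalgebra k (E × E)}

/-- The filter of elements of `G` approaching `t`. -/
def near (v : Valuation E Γ₀) (G : Subalgebra k (E × E)) (t : E) : Filter G :=
  ⨅ g₀ : G, 𝓟 {g | v (t - fstHom G g) ≤ v (t - fstHom G g₀)}

theorem near_hasBasis (t : E) : (near v G t).HasBasis (fun _ => True)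
    fun g₀ => {g | v (t - fstHom G g) ≤ v (t - fstHom G g₀)} := by
  refine hasBasis_iInf_principal fun g₁ g₂ => ?_
  rcases le_total (v (t - fstHom G g₁)) (v (t - fstHom G g₂)) with h | h
  · exact ⟨g₁, fun g hg => hg, fun g (hg : _ ≤ _) => hg.trans h⟩
  · exact ⟨g₂, fun g (hg : _ ≤ _) => hg.trans h, fun g hg => hg⟩

theorem eventually_near {t : E} {P : G → Prop} : (∀ᶠ g in near v G t, P g) ↔
    ∃ g₀, ∀ g, v (t - fstHom G g) ≤ v (t - fstHom G g₀) → P g := by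
  simpa using (near_hasBasis (v := v) (G := G) t).eventually_iff

instance near_neBot (t : E) : (near v G t).NeBot :=
  (near_hasBasis t).neBot_iff.2 fun {g} _ => ⟨g, le_refl (v (t - fstHom G g))⟩

/-- The `j`-th term of the Taylor expansion of `f` at `t` dominates near `t`. -/
def Dominates (v : Valuation E Γ₀) (G : Subalgebra k (E × E)) (t : E) (j : ℕ) (F : E[X]) : Prop :=
  ∀ᶠ g in near v G t, ∀ i, i ≠ j → v ((taylor t F).coeff i) * v (t - fstHom G g) ^ i
    < v ((taylor t F).coeff j) * v (t - fstHom G g) ^ j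

theorem dominates_of_derivative [CharZero k] (H : CoarseHenselian k v) {t : E}
    (hnear : ∀ g : G, ∃ g₂ : G, v (t - fstHom G g₂) < v (t - fstHom G g)) {F : E[X]}
    (hF : Dominates v G t 0 (derivative F)) : Dominates v G t 0 F ∨ Dominates v G t 1 F := by
  have hδ : ∀ g : G, 0 < v (t - fstHom G g) := fun g => by
    obtain ⟨g₂, h⟩ := hnear g
    exact zero_le.trans_lt h
  set T := taylor t F with hT
  have hF' : ∀ᶠ g in near v G t, ∀ i ≥ 2, v (T.coeff i) * v (t - fstHom G g) ^ i
      < v (T.coeff 1) * v (t - fstHom G g) := by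
    filter_upwards [hF] with g hg i hi
    have h := hg (i - 1) (by omega)
    rw [taylor_derivative_coeff, taylor_derivative_coeff, pow_zero, mul_one,
      Nat.sub_add_cancel (by omega), map_mul, map_mul, ← Nat.cast_add_one, ← Nat.cast_add_one,
      H.map_natCast_eq_one (by omega), H.map_natCast_eq_one (by omega), mul_one, mul_one] at h
    have e : v (t - fstHom G g) ^ i = v (t - fstHom G g) ^ (i - 1) * v (t - fstHom G g) := by
      rw [← pow_succ, Nat.sub_add_cancel (by omega)]
    rw [e, ← mul_assoc]
    exact mul_lt_mul_of_pos_right h (hδ g)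
  obtain ⟨g₀, hg₀⟩ := eventually_near.1 hF'
  by_cases hB : ∀ g, v (t - fstHom G g) ≤ v (t - fstHom G g₀) →
      v (T.coeff 0) ≤ v (T.coeff 1) * v (t - fstHom G g)
  · right
    refine eventually_near.2 ⟨g₀, fun g hg i hi => ?_⟩
    rcases i with _ | _ | i
    · obtain ⟨g₂, h2⟩ := hnear g
      rw [pow_zero, mul_one, pow_one]
      refine (hB g₂ (h2.le.trans hg)).trans_lt (mul_lt_mul_of_pos_left h2 ?_)
      have h1 := zero_le.trans_lt (hg₀ g hg 2 le_rfl)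
      exact pos_of_mul_pos_left h1 zero_le
    · exact (hi rfl).elim
    · rw [pow_one]
      exact hg₀ g hg (i + 2) (by omega)
  · left
    push Not at hB
    obtain ⟨g₁, hg₁, hlt⟩ := hB
    refine eventually_near.2 ⟨g₁, fun g hg i hi => ?_⟩
    rw [pow_zero, mul_one]
    have h1 : v (T.coeff 1) * v (t - fstHom G g) < v (T.coeff 0) :=
      (mul_le_mul_right hg _).trans_lt hlt
    rcases i with _ | _ | i
    · exact (hi rfl).elim
    · rwa [zero_add, pow_one]
    · exact (hg₀ g (hg.trans hg₁) (i + 2) (by omega)).trans h1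

theorem not_dominates_one (H : CoarseHenselian k v) {t : E}
    (hnear : ∀ g : G, ∃ g₂ : G, v (t - fstHom G g₂) < v (t - fstHom G g)) {F : E[X]}
    (hroot : ∀ b, F.eval b = 0 → ∃ g, fstHom G g = b) : ¬ Dominates v G t 1 F := by
  intro hd
  obtain ⟨g₀, hg₀⟩ := eventually_near.1 hd
  have hδ : t - fstHom G g₀ ≠ 0 := by
    obtain ⟨g₂, h⟩ := hnear g₀
    exact v.pos_iff.1 (zero_le.trans_lt h)
  have h0 := hg₀ g₀ le_rfl
  simp only [pow_one] at h0
  have h1 : (taylor t F).coeff 1 ≠ 0 :=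
    v.pos_iff.1 (pos_of_mul_pos_left (zero_le.trans_lt (h0 0 zero_ne_one)) zero_le)
  obtain ⟨u, hu, hroot0⟩ := H.exists_root _ _ hδ h1
    (by simpa using (h0 0 zero_ne_one).le) fun i hi => h0 i (by omega)
  obtain ⟨b, hb⟩ := hroot _ ((taylor_eval t F u).symm.trans hroot0)
  have hbu : t - fstHom G b = -u := by rw [hb]; ring
  have hvb : v (t - fstHom G b) = v u := by rw [hbu, v.map_neg]
  have hu0 : u ≠ 0 := by
    obtain ⟨g₂, h⟩ := hnear b
    exact v.pos_iff.1 (hvb ▸ zero_le.trans_lt h)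
  have h2 := hg₀ b (hvb.trans_le hu)
  rw [hvb] at h2
  have h3 := v.eval_sub_lt (taylor t F) u 1 (by
    rw [pow_one]
    exact mul_ne_zero h1 hu0) fun i hi => by
    simpa using h2 i hi
  rw [hroot0, zero_sub, v.map_neg] at h3
  exact lt_irrefl _ h3

theorem dominates_zero [CharZero k] (H : CoarseHenselian k v) (hG : Maximal Matches G) {t : E}
    (hnear : ∀ g : G, ∃ g₂ : G, v (t - fstHom G g₂) < v (t - fstHom G g)) (d : ℕ)
    (hroot : ∀ f : G[X], f ≠ 0 → f.natDegree < d → ∀ b, (f.map (fstHom G)).eval b = 0 →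
      ∃ g, fstHom G g = b) :
    ∀ f : G[X], f ≠ 0 → f.natDegree < d → Dominates v G t 0 (f.map (fstHom G)) := by
  have : CharZero E := charZero_of_injective_algebraMap (algebraMap k E).injective
  suffices h : ∀ n, ∀ f : G[X], f.natDegree = n → f ≠ 0 → f.natDegree < d →
      Dominates v G t 0 (f.map (fstHom G)) from fun f => h _ f rfl
  intro n
  induction n using Nat.strong_induction_on with
  | _ n ih =>
  intro f hfn hf hfd
  have hF : f.map (fstHom G) ≠ 0 := (Polynomial.map_ne_zero_iff hG.prop.fst_injective).2 hf
  have hFn : (f.map (fstHom G)).natDegree = f.natDegree :=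
    natDegree_map_eq_of_injective hG.prop.fst_injective f
  by_cases hn : n = 0
  · rw [hn] at hfn
    rw [eq_C_of_natDegree_eq_zero hfn] at hF ⊢
    refine Eventually.of_forall fun g i hi => ?_
    rw [map_C] at hF ⊢
    rw [taylor_C, coeff_C_of_ne_zero hi, coeff_C_zero, map_zero, zero_mul, pow_zero, mul_one]
    exact v.pos_iff.2 (C_ne_zero.1 hF)
  · have hlt : (derivative f).natDegree < f.natDegree := natDegree_derivative_lt (by omega)
    have hf' : derivative f ≠ 0 := by
      intro h0
      have h1 : derivative (f.map (fstHom G)) = 0 := by rw [derivative_map, h0, Polynomial.map_zero]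
      have := derivative_eq_zero.1 h1
      omega
    have h1 := ih _ (hfn ▸ hlt) (derivative f) rfl hf' (hlt.trans hfd)
    rw [← derivative_map] at h1
    exact (dominates_of_derivative H hnear h1).resolve_right
      (not_dominates_one H hnear (hroot f hf hfd))

theorem Dominates.eval_ne_zero {t : E} {F : E[X]} (h : Dominates v G t 0 F) : F.eval t ≠ 0 := by
  obtain ⟨g, hg⟩ := Eventually.exists h
  have := zero_le.trans_lt (hg 1 one_ne_zero)
  rw [pow_zero, mul_one, v.pos_iff, taylor_coeff_zero] at this
  exact this

theorem Dominates.eval_sub_lt {t : E} {F : E[X]} (h : Dominates v G t 0 F) :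
    ∀ᶠ g in near v G t, v (F.eval (fstHom G g) - F.eval t) < v (F.eval t) := by
  filter_upwards [h] with g hg
  have h1 := v.eval_sub_lt (taylor t F) (fstHom G g - t) 0
    (by simpa using h.eval_ne_zero) fun i hi => by
      rw [map_mul, map_mul, map_pow, map_pow, v.map_sub_swap]
      exact hg i hi
  simpa [taylor_eval] using h1

theorem Dominates.taylor_lt [CharZero k] (H : CoarseHenselian k v) {t : E} {f : G[X]}
    (h : Dominates v G t 0 (f.map (fstHom G))) :
    ∀ᶠ g in near v G t, ∀ i, i ≠ 0 → v (fstHom G ((taylor g f).coeff i)) * v (t - fstHom G g) ^ i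
      < v (fstHom G (f.eval g)) := by
  filter_upwards [h, h.eval_sub_lt] with g hg hs i hi
  have e : taylor (fstHom G g - t) (taylor t (f.map (fstHom G))) = (taylor g f).map (fstHom G) := by
    rw [taylor_taylor, map_taylor, sub_add_cancel]
  have hv : v ((f.map (fstHom G)).eval t) = v (fstHom G (f.eval g)) := by
    have h2 : (f.map (fstHom G)).eval (fstHom G g) = fstHom G (f.eval g) := by
      rw [eval_map, eval₂_at_apply]
    rw [← h2]
    exact (v.map_eq_of_sub_lt hs).symm
  rw [← coeff_map, ← e, v.map_sub_swap]
  refine H.taylor_coeff_lt _ _ _ (hv ▸ v.pos_iff.2 h.eval_ne_zero) fun i' hi' => ?_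
  have := hg i' (by omega)
  rw [pow_zero, mul_one, taylor_coeff_zero, hv, v.map_sub_swap] at this
  exact this

end Near

section Closed

open Polynomial

variable {k E Γ₀ : Type*} [Field k] [Field E] [Algebra k E]
  [LinearOrderedCommGroupWithZero Γ₀] {v : Valuation E Γ₀} {G : Subalgebra k (E × E)}

theorem Maximal.isVal_sub_of_root (H : CoarseHenselian k v) (hG : Maximal Matches G) {f : G[X]}
    (hf : f ≠ 0) {b : E} (hb : (f.map (fstHom G)).eval b = 0) (g : G) :
    IsVal v G (b - fstHom G g) := by
  by_cases h0 : b - fstHom G g = 0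
  · exact ⟨0, by rw [h0, map_zero]⟩
  by_contra hval
  have hS : (taylor g f).map (fstHom G) = taylor (fstHom G g) (f.map (fstHom G)) := map_taylor ..
  have hroot : ((taylor g f).map (fstHom G)).eval (b - fstHom G g) = 0 := by
    rw [hS, taylor_eval, sub_add_cancel, hb]
  obtain ⟨j, hj, hdom⟩ := hG.exists_dominant (v := v) (D := f.natDegree + 1)
    (fun m h0 _ h => hval (hG.isVal_of_pow H ⟨m, h0, h⟩)) h0 ((taylor_eq_zero g f).not.2 hf)
    (by rw [natDegree_taylor]; omega)
  have h1 := v.eval_sub_lt ((taylor g f).map (fstHom G)) (b - fstHom G g) j (by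
    rw [coeff_map]
    exact mul_ne_zero ((map_ne_zero_iff _ hG.prop.fst_injective).2 hj) (pow_ne_zero _ h0))
    (by simpa only [coeff_map] using hdom)
  rw [hroot, zero_sub, v.map_neg] at h1
  exact lt_irrefl _ h1

/-- Near a root of `q`, Hensel's lemma produces a root on the other side. -/
theorem Maximal.eventually_exists_root [CharZero k] (H : CoarseHenselian k v)
    (hG : Maximal Matches G) {q : G[X]} {b : E} (hq1 : Dominates v G b 1 (q.map (fstHom G)))
    (hq0 : Dominates v G b 0 ((derivative q).map (fstHom G))) :
    ∀ᶠ g in near v G b, ∀ h : G, h ≠ 0 → v (fstHom G h) = v (b - fstHom G g) →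
      (taylor (sndHom G g) (q.map (sndHom G))).coeff 1 ≠ 0 ∧
      (∀ i ≥ 2, v ((taylor (sndHom G g) (q.map (sndHom G))).coeff i) * v (sndHom G h) ^ i
        < v ((taylor (sndHom G g) (q.map (sndHom G))).coeff 1) * v (sndHom G h)) ∧
      ∃ u, v u ≤ v (sndHom G h) ∧ (taylor (sndHom G g) (q.map (sndHom G))).eval u = 0 := by
  filter_upwards [hq1, hq0.eval_sub_lt] with g hg hs h h0 hh
  set T := taylor b (q.map (fstHom G)) with hT
  have hφh : 0 < v (fstHom G h) := v.pos_iff.2 ((map_ne_zero_iff _ hG.prop.fst_injective).2 h0)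
  have hS : taylor (fstHom G g) (q.map (fstHom G)) = (taylor g q).map (fstHom G) :=
    (map_taylor ..).symm
  have hS' : taylor (sndHom G g) (q.map (sndHom G)) = (taylor g q).map (sndHom G) :=
    (map_taylor ..).symm
  have hTS : taylor (fstHom G g - b) T = (taylor g q).map (fstHom G) := by
    rw [hT, taylor_taylor, sub_add_cancel, hS]
  have h1 : v (T.coeff 1) = v (fstHom G ((taylor g q).coeff 1)) := by
    rw [← coeff_map, ← hS, taylor_coeff_one, hT, taylor_coeff_one, ← derivative_map] at *
    exact (v.map_eq_of_sub_lt hs).symm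
  have hvh : v (fstHom G g - b) = v (fstHom G h) := by rw [hh, v.map_sub_swap]
  rw [← hh] at hg
  simp only [pow_one] at hg
  have hpos : 0 < v (T.coeff 1) * v (fstHom G h) := zero_le.trans_lt (hg 0 zero_ne_one)
  have hc : ∀ i ≥ 2, v (fstHom G ((taylor g q).coeff i)) * v (fstHom G h) ^ i
      < v (fstHom G ((taylor g q).coeff 1)) * v (fstHom G h) := fun i hi => by
    rw [← h1, ← coeff_map, ← hTS, ← hvh]
    rw [← hvh] at hpos hg
    exact H.taylor_coeff_lt T _ i hpos fun i' hi' => hg i' (by omega)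
  have hc1 : (taylor g q).coeff 1 ≠ 0 := by
    intro h2
    rw [h1, h2, map_zero, map_zero, zero_mul] at hpos
    exact lt_irrefl _ hpos
  have hc0 : v (fstHom G ((taylor g q).coeff 0))
      ≤ v (fstHom G ((taylor g q).coeff 1)) * v (fstHom G h) := by
    have hne : T.coeff 1 * (fstHom G g - b) ^ 1 ≠ 0 := by
      rw [pow_one, ← v.pos_iff, map_mul, hvh]
      exact hpos
    have h2 := v.eval_sub_lt T (fstHom G g - b) 1 hne fun i hi => by
      rw [map_mul, map_mul, map_pow, pow_one, hvh]
      exact hg i hi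
    have h3 := v.map_eq_of_sub_lt h2
    rw [map_mul, pow_one, hvh, h1] at h3
    rw [← h3, hT, taylor_eval, sub_add_cancel, taylor_coeff_zero, eval_map, eval₂_at_apply]
  rw [hS']
  have hc1' : sndHom G ((taylor g q).coeff 1) ≠ 0 :=
    (map_ne_zero_iff _ hG.prop.snd_injective).2 hc1
  have hc' : ∀ i ≥ 2, v (sndHom G ((taylor g q).coeff i)) * v (sndHom G h) ^ i
      < v (sndHom G ((taylor g q).coeff 1)) * v (sndHom G h) := fun i hi => by
    have := hc i hi
    rw [← map_pow, ← map_pow, ← map_mul, ← map_mul, ← map_mul, ← map_mul, hG.val_lt_iff H] at this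
    simpa using this
  have hc0' : v (sndHom G ((taylor g q).coeff 0))
      ≤ v (sndHom G ((taylor g q).coeff 1)) * v (sndHom G h) := by
    rw [← map_mul, ← map_mul, hG.val_le_iff H] at hc0
    simpa only [map_mul] using hc0
  simp only [coeff_map]
  exact ⟨hc1', hc', H.exists_root _ (sndHom G h)
    ((map_ne_zero_iff _ hG.prop.snd_injective).2 h0) (by rwa [coeff_map])
    (by simpa only [coeff_map]) (by simpa only [coeff_map])⟩

/-- The first projection of a maximal matching subalgebra is relatively algebraically closed. -/
theorem Maximal.exists_of_root [CharZero k] (H : CoarseHenselian k v) (hG : Maximal Matches G)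
    (d : ℕ) :
    ∀ f : G[X], f ≠ 0 → f.natDegree < d → ∀ b, (f.map (fstHom G)).eval b = 0 →
      ∃ g, fstHom G g = b := by
  induction d with
  | zero => intro f _ h; omega
  | succ d ih =>
  intro f hf hfd b hb
  by_contra hbG
  push Not at hbG
  rcases Nat.lt_succ_iff_lt_or_eq.1 hfd with h | hfd
  · obtain ⟨g, hg⟩ := ih f hf h b hb
    exact hbG g hg
  nontriviality G
  have : CharZero E := charZero_of_injective_algebraMap (algebraMap k E).injective
  obtain ⟨q, hq, hqd, hqb⟩ : ∃ q : G[X], q.Monic ∧ q.natDegree = d ∧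
      (q.map (fstHom G)).eval b = 0 := by
    obtain ⟨i, hi⟩ := hG.exists_inv (leadingCoeff_ne_zero.2 hf)
    have hm : (C i * f).Monic := by
      refine monic_C_mul_of_mul_leadingCoeff_eq_one ?_
      rwa [mul_comm]
    refine ⟨C i * f, hm, ?_, by simp [hb]⟩
    rw [natDegree_C_mul_of_mul_ne_zero, hfd]
    rw [mul_comm, hi]
    exact one_ne_zero
  have hnear : ∀ g : G, ∃ g₂ : G, v (b - fstHom G g₂) < v (b - fstHom G g) := fun g =>
    Maximal.exists_nearer H (hbG g).symm (hG.isVal_sub_of_root H hq.ne_zero hqb g)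
  have hdom := dominates_zero H hG hnear d ih
  have hd : d ≠ 0 := by
    rintro rfl
    rw [hq.natDegree_eq_zero.1 hqd] at hqb
    simp at hqb
  have hq' : derivative q ≠ 0 := by
    intro h0
    have h1 : derivative (q.map (fstHom G)) = 0 := by rw [derivative_map, h0, Polynomial.map_zero]
    have := derivative_eq_zero.1 h1
    rw [natDegree_map_eq_of_injective hG.prop.fst_injective] at this
    omega
  have hq0 := hdom _ hq' (hqd ▸ natDegree_derivative_lt (by omega))
  have hq1 : Dominates v G b 1 (q.map (fstHom G)) := by
    have := hq0
    rw [← derivative_map] at this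
    exact (dominates_of_derivative H hnear this).resolve_left fun h => h.eval_ne_zero hqb
  have hval : ∀ g : G, ∃ h : G, h ≠ 0 ∧ v (fstHom G h) = v (b - fstHom G g) := fun g => by
    obtain ⟨h, hh⟩ := hG.isVal_sub_of_root H hq.ne_zero hqb g
    refine ⟨h, ?_, hh⟩
    rintro rfl
    rw [map_zero, map_zero] at hh
    obtain ⟨g₂, hlt⟩ := hnear g
    exact not_lt_zero (hh ▸ hlt)
  obtain ⟨g₀, hg₀⟩ := eventually_near.1 (hG.eventually_exists_root H hq1 hq0)
  obtain ⟨h₀, hh₀0, hh₀⟩ := hval g₀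
  obtain ⟨hc1, hc, u₀, hu₀, hr₀⟩ := hg₀ g₀ le_rfl h₀ hh₀0 hh₀
  set b' := u₀ + sndHom G g₀ with hb'
  have hb'q : (q.map (sndHom G)).eval b' = 0 := (taylor_eval ..).symm.trans hr₀
  have hclose : ∀ g, v (b - fstHom G g) ≤ v (b - fstHom G g₀) → ∀ h : G, h ≠ 0 →
      v (fstHom G h) = v (b - fstHom G g) → v (b' - sndHom G g) ≤ v (sndHom G h) := by
    intro g hg h h0 hh
    obtain ⟨-, -, u, hu, hr⟩ := hg₀ g hg h h0 hh
    have hsub : v (sndHom G (g - g₀)) ≤ v (sndHom G h₀) := by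
      rw [← hG.val_le_iff H, hh₀, map_sub]
      have e : fstHom G g - fstHom G g₀ = (b - fstHom G g₀) - (b - fstHom G g) := by ring
      rw [e]
      exact v.map_sub_le le_rfl hg
    have hle : v (sndHom G h) ≤ v (sndHom G h₀) := by
      rwa [← hG.val_le_iff H, hh₀, hh]
    have heq : u + sndHom G (g - g₀) = u₀ := by
      refine v.root_unique _ (sndHom G h₀)
        ((map_ne_zero_iff _ hG.prop.snd_injective).2 hh₀0) hc1 hc
        (v.map_add_le (hu.trans hle) hsub) hu₀ ?_ hr₀
      rw [taylor_eval] at hr ⊢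
      rw [map_sub, add_assoc, sub_add_cancel, hr]
    have : b' - sndHom G g = u := by
      rw [hb', ← heq, map_sub]
      ring
    rwa [this]
  refine hbG ⟨(b, b'), hG.mk_mem_of_monic hq hqb hb'q fun f hf hfd N hN => ?_⟩ rfl
  have hf0 := hdom f hf (hqd ▸ natDegree_lt_natDegree hf hfd)
  obtain ⟨g, ⟨hgt, hgs⟩, hgle⟩ := (((hf0.taylor_lt H).and hf0.eval_sub_lt).and
    (eventually_near.2 ⟨g₀, fun g hg => hg⟩)).exists
  obtain ⟨h, h0, hh⟩ := hval g
  have hb'g := hclose g hgle h h0 hh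
  have e1 : (f.map (fstHom G)).eval (fstHom G g) = fstHom G (f.eval g) := by
    rw [eval_map, eval₂_at_apply]
  rw [← H.isPow_congr hN hgs, e1, hG.prop.isPow_iff _ hN]
  have hfg : f.eval g ≠ 0 := by
    intro h2
    have := hgt 1 one_ne_zero
    rw [h2, map_zero, map_zero] at this
    exact not_lt_zero this
  have h3 := H.isPow_eval_iff (P := (taylor g f).map (sndHom G)) (s := b' - sndHom G g) (j := 0)
    (by
      rw [pow_zero, mul_one, coeff_map, taylor_coeff_zero]
      exact (map_ne_zero_iff _ hG.prop.snd_injective).2 hfg) (fun i hi => by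
      have h4 := hgt i hi
      rw [← hh, ← map_pow, ← map_pow, ← map_mul, ← map_mul, hG.val_lt_iff H] at h4
      rw [pow_zero, mul_one, coeff_map, coeff_map, taylor_coeff_zero, map_mul, map_pow]
      refine lt_of_le_of_lt ?_ h4
      rw [map_mul, map_mul, map_pow, map_pow]
      gcongr) hN
  rw [map_taylor, taylor_eval, sub_add_cancel] at h3
  rw [h3, pow_zero, mul_one, taylor_coeff_zero, eval_map, eval₂_at_apply]

end Closed

section Cut

open Polynomial

variable {k E Γ₀ : Type*} [Field k] [Field E] [Algebra k E]
  [LinearOrderedCommGroupWithZero Γ₀] {v : Valuation E Γ₀} {G : Subalgebra k (E × E)}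

/-- The cut in the value group induced by `s`, transferred along `G`. -/
def cut (v : Valuation E Γ₀) (G : Subalgebra k (E × E)) (s : E) : Filter Γ₀ :=
  (⨅ g : {g : G // v (fstHom G g) < v s}, 𝓟 (Set.Ioi (v (sndHom G g)))) ⊓
    ⨅ g : {g : G // v s < v (fstHom G g)}, 𝓟 (Set.Iio (v (sndHom G g)))

theorem eventually_cut_gt {s : E} {g : G} (h : v (fstHom G g) < v s) :
    ∀ᶠ γ in cut v G s, v (sndHom G g) < γ :=
  mem_inf_of_left (mem_iInf_of_mem ⟨g, h⟩ (mem_principal_self _))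

theorem eventually_cut_lt {s : E} {g : G} (h : v s < v (fstHom G g)) :
    ∀ᶠ γ in cut v G s, γ < v (sndHom G g) :=
  mem_inf_of_right (mem_iInf_of_mem ⟨g, h⟩ (mem_principal_self _))

theorem Valuation.exists_gt_one {F Γ₀ : Type*} [Field F]
    [LinearOrderedCommGroupWithZero Γ₀] (v : Valuation F Γ₀) {s : F} (hs0 : s ≠ 0)
    (hs : v s ≠ 1) : ∃ γ : Γ₀, 1 < γ := by
  rcases hs.lt_or_gt with h | h
  · exact ⟨(v s)⁻¹, (one_lt_inv₀ (v.pos_iff.2 hs0)).2 h⟩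
  · exact ⟨_, h⟩

theorem CoarseHenselian.exists_between (H : CoarseHenselian k v) {s : E} (hs0 : s ≠ 0)
    (hs : v s ≠ 1) {a b : Γ₀} (hab : a < b) : ∃ c, a < c ∧ c < b := by
  have hb : 0 < b := zero_le.trans_lt hab
  by_cases ha : a = 0
  · subst ha
    obtain ⟨γ, hγ⟩ := v.exists_gt_one hs0 hs
    have hγ0 : 0 < γ := zero_lt_one.trans hγ
    exact ⟨b / γ, div_pos hb hγ0, (div_lt_iff₀ hγ0).2 (lt_mul_of_one_lt_right hb hγ)⟩
  have ha : 0 < a := zero_lt_iff.2 ha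
  obtain ⟨x, hx⟩ := H.surj (a * b)
  obtain ⟨z, hz⟩ := H.exists_pow_eq 2 two_pos x
  rw [hx] at hz
  refine ⟨v z, ?_, ?_⟩
  · refine lt_of_pow_lt_pow_left₀ 2 zero_le ?_
    rw [hz, sq]
    exact mul_lt_mul_of_pos_left hab ha
  · refine lt_of_pow_lt_pow_left₀ 2 zero_le ?_
    rw [hz, sq]
    exact mul_lt_mul_of_pos_right hab hb

theorem cut_neBot (H : CoarseHenselian k v) (hG : Maximal Matches G) {s : E} (hs0 : s ≠ 0)
    (hs : v s ≠ 1) : (cut v G s).NeBot := by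
  have hL : (⨅ g : {g : G // v (fstHom G g) < v s}, 𝓟 (Set.Ioi (v (sndHom G g)))).HasBasis
      (fun _ => True) fun g : {g : G // v (fstHom G g) < v s} => Set.Ioi (v (sndHom G g.1)) := by
    have : Nonempty {g : G // v (fstHom G g) < v s} := ⟨⟨0, by simpa [v.pos_iff]⟩⟩
    refine hasBasis_iInf_principal fun g₁ g₂ => ?_
    rcases le_total (v (sndHom G g₁)) (v (sndHom G g₂)) with h | h
    · exact ⟨g₂, fun γ hγ => h.trans_lt hγ, fun γ hγ => hγ⟩
    · exact ⟨g₁, fun γ hγ => hγ, fun γ hγ => h.trans_lt hγ⟩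
  by_cases hne : Nonempty {g : G // v s < v (fstHom G g)}
  · have hU : (⨅ g : {g : G // v s < v (fstHom G g)}, 𝓟 (Set.Iio (v (sndHom G g)))).HasBasis
        (fun _ => True) fun g : {g : G // v s < v (fstHom G g)} => Set.Iio (v (sndHom G g.1)) := by
      refine hasBasis_iInf_principal fun g₁ g₂ => ?_
      rcases le_total (v (sndHom G g₁)) (v (sndHom G g₂)) with h | h
      · exact ⟨g₁, fun γ hγ => hγ, fun γ hγ => lt_of_lt_of_le hγ h⟩
      · exact ⟨g₂, fun γ hγ => lt_of_lt_of_le hγ h, fun γ hγ => hγ⟩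
    refine (hL.inf hU).neBot_iff.2 fun {g} _ => ?_
    have hlt := (hG.val_lt_iff H _ _).1 (g.1.2.trans g.2.2)
    exact H.exists_between hs0 hs hlt
  · rw [not_nonempty_iff] at hne
    rw [cut, iInf_of_empty (ι := {g : G // v s < v (fstHom G g)}), inf_top_eq]
    refine hL.neBot_iff.2 fun {g} _ => ?_
    obtain ⟨γ, hγ⟩ := v.exists_gt_one hs0 hs
    by_cases h0 : v (sndHom G g) = 0
    · exact ⟨γ, h0 ▸ zero_lt_one.trans hγ⟩
    · exact ⟨v (sndHom G g) * γ, lt_mul_of_one_lt_right (zero_lt_iff.2 h0) hγ⟩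

theorem Maximal.exists_pow_isVal (H : CoarseHenselian k v) (hG : Maximal Matches G) {a b : G}
    (hb : b ≠ 0) {N : ℕ} (hN : 0 < N) :
    ∃ c : G, v (fstHom G b) * v (fstHom G c) ^ N = v (fstHom G a) := by
  obtain ⟨q, hq⟩ := hG.isVal_div (v := v) (x := fstHom G a) (y := fstHom G b) ⟨a, rfl⟩ ⟨b, rfl⟩
  obtain ⟨z, hz⟩ := H.exists_pow_eq N hN (fstHom G q)
  obtain ⟨c, hc⟩ := hG.isVal_of_pow H (s := z) ⟨N, hN, q, by rw [map_pow, hz]⟩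
  refine ⟨c, ?_⟩
  rw [hc, hz, hq, map_div₀, mul_div_cancel₀]
  simpa using (map_ne_zero_iff _ hG.prop.fst_injective).2 hb

theorem Maximal.eventually_mul_pow_lt (H : CoarseHenselian k v) (hG : Maximal Matches G) {s : E}
    (hs0 : s ≠ 0) {a b : G} {i j : ℕ} (hij : i ≠ j) (hb : b ≠ 0)
    (h : v (fstHom G a) * v s ^ i < v (fstHom G b) * v s ^ j) :
    ∀ᶠ γ in cut v G s, v (sndHom G a) * γ ^ i < v (sndHom G b) * γ ^ j := by
  have hvs : 0 < v s := v.pos_iff.2 hs0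
  have hpos : ∀ᶠ γ in cut v G s, 0 < γ := by
    have := eventually_cut_gt (v := v) (s := s) (g := (0 : G)) (by simpa using hvs)
    simpa using this
  by_cases ha : a = 0
  · filter_upwards [hpos] with γ hγ
    rw [ha, map_zero, map_zero, zero_mul]
    exact mul_pos (v.pos_iff.2 ((map_ne_zero_iff _ hG.prop.snd_injective).2 hb)) (pow_pos hγ _)
  have transfer : ∀ {x y c : G} {N : ℕ}, v (fstHom G x) * v (fstHom G c) ^ N = v (fstHom G y) →
      v (sndHom G x) * v (sndHom G c) ^ N = v (sndHom G y) := fun {x y c N} e => by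
    simp only [← map_pow, ← map_mul] at e ⊢
    exact le_antisymm ((hG.val_le_iff H _ _).1 e.le) ((hG.val_le_iff H _ _).1 e.ge)
  rcases hij.lt_or_gt with hlt | hlt
  · obtain ⟨c, hc⟩ := hG.exists_pow_isVal (v := v) H (a := a) hb (Nat.sub_pos_of_lt hlt)
    have hsplit : ∀ γ : Γ₀, γ ^ j = γ ^ (j - i) * γ ^ i := fun γ => by
      rw [← pow_add, Nat.sub_add_cancel hlt.le]
    have hcs : v (fstHom G c) < v s := by
      rw [← hc, hsplit, ← mul_assoc] at h
      have h1 := lt_of_mul_lt_mul_right h zero_le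
      exact lt_of_pow_lt_pow_left₀ _ zero_le (lt_of_mul_lt_mul_left h1 zero_le)
    filter_upwards [hpos, eventually_cut_gt hcs] with γ hγ hcγ
    rw [← transfer hc, hsplit, ← mul_assoc]
    refine mul_lt_mul_of_pos_right (mul_lt_mul_of_pos_left ?_ ?_) (pow_pos hγ _)
    · exact pow_lt_pow_left₀ hcγ zero_le (by omega)
    · exact v.pos_iff.2 ((map_ne_zero_iff _ hG.prop.snd_injective).2 hb)
  · obtain ⟨c, hc⟩ := hG.exists_pow_isVal (v := v) H (a := b) ha (Nat.sub_pos_of_lt hlt)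
    have hsplit : ∀ γ : Γ₀, γ ^ i = γ ^ (i - j) * γ ^ j := fun γ => by
      rw [← pow_add, Nat.sub_add_cancel hlt.le]
    have hcs : v s < v (fstHom G c) := by
      rw [← hc, hsplit, ← mul_assoc] at h
      have h1 := lt_of_mul_lt_mul_right h zero_le
      exact lt_of_pow_lt_pow_left₀ _ zero_le (lt_of_mul_lt_mul_left h1 zero_le)
    filter_upwards [hpos, eventually_cut_lt hcs] with γ hγ hcγ
    rw [← transfer hc, hsplit, ← mul_assoc]
    refine mul_lt_mul_of_pos_right (mul_lt_mul_of_pos_left ?_ ?_) (pow_pos hγ _)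
    · exact pow_lt_pow_left₀ hcγ zero_le (by omega)
    · exact v.pos_iff.2 ((map_ne_zero_iff _ hG.prop.snd_injective).2 ha)

/-- Transfer of finitely many conditions on an element whose value is independent of `G`. -/
theorem Maximal.exists_match_of_not_isVal (H : CoarseHenselian k v) (hG : Maximal Matches G) {s : E}
    (hs : ¬ IsVal v G s) (Φ : Finset (G[X] × ℕ+)) :
    ∃ s' : E, ∀ x ∈ Φ, IsPow x.2 ((x.1.map (fstHom G)).eval s) ↔
      IsPow x.2 ((x.1.map (sndHom G)).eval s') := by
  have hs0 : s ≠ 0 := by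
    rintro rfl
    exact hs ⟨0, by simp⟩
  have hs1 : v s ≠ 1 := fun h => hs ⟨1, by simp [h]⟩
  have := cut_neBot H hG hs0 hs1
  have hdom : ∀ x ∈ Φ, ∀ᶠ γ in cut v G s, x.1 ≠ 0 → ∃ j, x.1.coeff j ≠ 0 ∧
      (∀ i, i ≠ j → v (fstHom G (x.1.coeff i)) * v s ^ i < v (fstHom G (x.1.coeff j)) * v s ^ j) ∧
      ∀ i, i ≠ j → v (sndHom G (x.1.coeff i)) * γ ^ i < v (sndHom G (x.1.coeff j)) * γ ^ j := by
    intro x _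
    by_cases hx : x.1 = 0
    · exact Eventually.of_forall fun γ h => (h hx).elim
    obtain ⟨j, hj, hd⟩ := hG.exists_dominant (v := v) (D := x.1.natDegree + 1)
      (fun m h0 _ h => hs (hG.isVal_of_pow H ⟨m, h0, h⟩)) hs0 hx (Nat.lt_succ_self _)
    have hd' : ∀ i, i ≠ j →
        v (fstHom G (x.1.coeff i)) * v s ^ i < v (fstHom G (x.1.coeff j)) * v s ^ j :=
      fun i hi => by simpa using hd i hi
    have hpos : ∀ᶠ γ in cut v G s, 0 < γ := by
      have := eventually_cut_gt (v := v) (s := s) (g := (0 : G)) (by simpa [v.pos_iff] using hs0)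
      simpa using this
    have h1 : ∀ i ∈ x.1.support, ∀ᶠ γ in cut v G s, i ≠ j →
        v (sndHom G (x.1.coeff i)) * γ ^ i < v (sndHom G (x.1.coeff j)) * γ ^ j := fun i _ => by
      by_cases hij : i = j
      · exact Eventually.of_forall fun γ h => (h hij).elim
      · filter_upwards [hG.eventually_mul_pow_lt H hs0 hij hj (hd' i hij)] with γ hγ _ using hγ
    filter_upwards [(eventually_all_finset _).2 h1, hpos] with γ hγ hγ0 _
    refine ⟨j, hj, hd', fun i hi => ?_⟩
    by_cases hc : x.1.coeff i = 0
    · rw [hc, map_zero, map_zero, zero_mul]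
      exact mul_pos (v.pos_iff.2 ((map_ne_zero_iff _ hG.prop.snd_injective).2 hj)) (pow_pos hγ0 _)
    · exact hγ i (mem_support_iff.2 hc) hi
  obtain ⟨γ, hγ, hγ0⟩ := (((eventually_all_finset _).2 hdom).and
    (eventually_cut_gt (v := v) (s := s) (g := (0 : G)) (by simpa [v.pos_iff] using hs0))).exists
  rw [map_zero, map_zero] at hγ0
  obtain ⟨s₁, rfl⟩ := H.surj γ
  have hs₁ : s₁ ≠ 0 := v.pos_iff.1 hγ0
  set M : ℕ := ∏ x ∈ Φ, (x.2 : ℕ) with hM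
  have hM0 : 0 < M := Finset.prod_pos fun x _ => x.2.pos
  obtain ⟨c, hc, hcs⟩ := H.exists_isPow_mul M hM0 s hs0
  obtain ⟨c₁, hc₁, hcs₁⟩ := H.exists_isPow_mul M hM0 s₁ hs₁
  have hcE : algebraMap k E c ≠ 0 := by simpa using hc
  set s' := algebraMap k E (c⁻¹ * c₁) * s₁ with hs'
  have hvs' : v s' = v s₁ := by
    rw [hs', map_mul, H.map_const _ (mul_ne_zero (inv_ne_zero hc) hc₁), one_mul]
  have hs'0 : s' ≠ 0 := v.pos_iff.1 (hvs' ▸ hγ0)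
  have hcs' : IsPow M (algebraMap k E c * s') := by
    rwa [hs', map_mul, map_inv₀, mul_assoc, mul_inv_cancel_left₀ hcE]
  refine ⟨s', fun x hx => ?_⟩
  by_cases hx0 : x.1 = 0
  · simp [hx0]
  obtain ⟨j, hj, hd, hd'⟩ := hγ x hx hx0
  have hdvd : (x.2 : ℕ) ∣ M := Finset.dvd_prod_of_mem (fun x => (x.2 : ℕ)) hx
  rw [H.isPow_eval_iff (j := j) _ _ x.2.pos, H.isPow_eval_iff (j := j) _ _ x.2.pos, coeff_map,
    coeff_map]
  · exact hG.prop.isPow_mul_pow_iff x.2.pos hc (hcs.of_dvd hdvd) (hcs'.of_dvd hdvd) _ _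
  · rw [coeff_map]
    exact mul_ne_zero ((map_ne_zero_iff _ hG.prop.snd_injective).2 hj) (pow_ne_zero _ hs'0)
  · simpa only [coeff_map, map_mul, map_pow, hvs'] using hd'
  · rw [coeff_map]
    exact mul_ne_zero ((map_ne_zero_iff _ hG.prop.fst_injective).2 hj) (pow_ne_zero _ hs0)
  · simpa only [coeff_map, map_mul, map_pow] using hd

/-- Every element of `E` can be matched by another one with respect to finitely many power
conditions over a maximal matching subalgebra. -/
theorem Maximal.exists_match [CharZero k] (H : CoarseHenselian k v) (hG : Maximal Matches G) (t : E)
    (Φ : Finset (G[X] × ℕ+)) :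
    ∃ t' : E, ∀ x ∈ Φ, IsPow x.2 ((x.1.map (fstHom G)).eval t) ↔
      IsPow x.2 ((x.1.map (sndHom G)).eval t') := by
  classical
  have heval : ∀ (φ : G →+* E) (f : G[X]) g, (f.map φ).eval (φ g) = φ (f.eval g) := fun φ f g => by
    rw [eval_map, eval₂_at_apply]
  by_cases ht : ∃ g, fstHom G g = t
  · obtain ⟨g, rfl⟩ := ht
    refine ⟨sndHom G g, fun x _ => ?_⟩
    rw [heval, heval]
    exact hG.prop.isPow_iff _ x.2.pos
  push Not at ht
  by_cases hnear : ∀ g : G, ∃ g₂ : G, v (t - fstHom G g₂) < v (t - fstHom G g)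
  · have h1 : ∀ x ∈ Φ, ∀ᶠ g in near v G t, IsPow x.2 ((x.1.map (fstHom G)).eval t) ↔
        IsPow x.2 ((x.1.map (sndHom G)).eval (sndHom G g)) := fun x _ => by
      by_cases hx : x.1 = 0
      · simp [hx]
      have hd := dominates_zero H hG hnear (x.1.natDegree + 1) (hG.exists_of_root H _) x.1 hx
        (Nat.lt_succ_self _)
      filter_upwards [hd.eval_sub_lt] with g hg
      rw [← H.isPow_congr x.2.pos hg, heval, heval]
      exact hG.prop.isPow_iff _ x.2.pos
    obtain ⟨g, hg⟩ := ((eventually_all_finset _).2 h1).exists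
    exact ⟨_, hg⟩
  · push Not at hnear
    obtain ⟨g, hg⟩ := hnear
    have hs : ¬ IsVal v G (t - fstHom G g) := fun h => by
      obtain ⟨g₂, h2⟩ := Maximal.exists_nearer H (ht g).symm h
      exact (hg g₂).not_gt h2
    obtain ⟨s', hs'⟩ := hG.exists_match_of_not_isVal H hs
      (Φ.image fun x => (taylor g x.1, x.2))
    refine ⟨s' + sndHom G g, fun x hx => ?_⟩
    have := hs' _ (Finset.mem_image_of_mem _ hx)
    simpa only [map_taylor, taylor_eval, sub_add_cancel] using this

end Cut

section Powers

open Polynomial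

variable {K : Type*} [NontriviallyNormedField K] [CompleteSpace K] [CharZero K] {N : ℕ}

theorem IsPow.eventually_one (hN : 0 < N) : ∀ᶠ z in 𝓝 (1 : K), IsPow N z := by
  have h := (hasStrictDerivAt_pow N (1 : K)).map_nhds_eq (by simpa using hN.ne')
  rw [one_pow] at h
  rw [← h, eventually_map]
  filter_upwards [isOpen_ne.mem_nhds (one_ne_zero (α := K))] with y hy
  exact IsPow.pow_self hy

theorem IsPow.exists_ball (hN : 0 < N) : ∃ ε > 0, ∀ z : K, ‖z‖ < ε → IsPow N (1 + z) := by
  obtain ⟨ε, hε, h⟩ := Metric.eventually_nhds_iff.1 (IsPow.eventually_one (K := K) hN)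
  exact ⟨ε, hε, fun z hz => h (by simpa using hz)⟩

theorem IsPow.eventually_inv_mul (hN : 0 < N) {x : K} (hx : x ≠ 0) :
    ∀ᶠ y in 𝓝 x, IsPow N (x⁻¹ * y) := by
  have h : Tendsto (fun y => x⁻¹ * y) (𝓝 x) (𝓝 1) := by
    simpa [inv_mul_cancel₀ hx] using (continuous_const_mul x⁻¹).tendsto x
  exact h.eventually (IsPow.eventually_one hN)

theorem IsPow.eventually_iff (hN : 0 < N) {x : K} (hx : x ≠ 0) :
    ∀ᶠ y in 𝓝 x, (IsPow N y ↔ IsPow N x) := by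
  filter_upwards [IsPow.eventually_inv_mul hN hx] with y hy
  rw [← mul_inv_cancel_left₀ hx y, hy.mul_iff_right]

end Powers

namespace Padic

open Polynomial

variable {p : ℕ} [Fact p.Prime]

/-- The nonzero `N`-th powers have finite index in the multiplicative group of `ℚ_p`. -/
theorem exists_finset_isPow_mul {N : ℕ} (hN : 0 < N) :
    ∃ S : Finset ℚ_[p], ∀ x ≠ 0, ∃ c ∈ S, IsPow N (c * x) := by
  classical
  have hp : (p : ℚ_[p]) ≠ 0 := by exact_mod_cast (Fact.out : p.Prime).ne_zero
  set R : ℝ := ‖((p : ℚ_[p]) ^ N)⁻¹‖ with hR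
  have hR1 : 1 < R := by
    rw [hR, norm_inv, norm_pow]
    exact (one_lt_inv₀ (by positivity)).2 (pow_lt_one₀ (norm_nonneg _) norm_p_lt_one hN.ne')
  set T : Set ℚ_[p] := {x | 1 ≤ ‖x‖ ∧ ‖x‖ ≤ R} with hT
  have hTc : IsCompact T := by
    refine Metric.isCompact_of_isClosed_isBounded ?_ ?_
    · exact (isClosed_le continuous_const continuous_norm).inter
        (isClosed_le continuous_norm continuous_const)
    · exact (Metric.isBounded_closedBall (x := 0) (r := R)).subset fun x hx => by simpa using hx.2
  have h0 : ∀ x ∈ T, x ≠ 0 := fun x hx => norm_pos_iff.1 (zero_lt_one.trans_le hx.1)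
  obtain ⟨t, ht, hcov⟩ := hTc.elim_nhds_subcover (fun x => {y | IsPow N (x⁻¹ * y)})
    fun x hx => IsPow.eventually_inv_mul hN (h0 x hx)
  refine ⟨t.image (·⁻¹), fun x hx => ?_⟩
  obtain ⟨n, hn⟩ := exists_mem_Ico_zpow (norm_pos_iff.2 hx) hR1
  have hw : IsPow N (((p : ℚ_[p]) ^ N) ^ n) :=
    ⟨(p : ℚ_[p]) ^ n, zpow_ne_zero _ hp, by rw [← zpow_natCast, ← zpow_natCast, zpow_comm]⟩
  have hwn : ‖((p : ℚ_[p]) ^ N) ^ n‖ = (R ^ n)⁻¹ := by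
    rw [hR, norm_inv, norm_zpow, inv_zpow, inv_inv]
  have hRn : 0 < R ^ n := by positivity
  have hmem : x * ((p : ℚ_[p]) ^ N) ^ n ∈ T := by
    rw [hT, Set.mem_ofPred_eq, norm_mul, hwn, ← div_eq_mul_inv, le_div_iff₀ hRn, div_le_iff₀ hRn,
      one_mul, ← zpow_one_add₀ (by positivity), add_comm]
    exact ⟨hn.1, hn.2.le⟩
  obtain ⟨c, hc, h⟩ := Set.mem_iUnion₂.1 (hcov hmem)
  refine ⟨c⁻¹, Finset.mem_image_of_mem _ hc, ?_⟩
  rw [Set.mem_ofPred_eq, ← mul_assoc, hw.mul_iff_right] at h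
  exact h

theorem norm_sq_le_of_isPow {n : ℕ} {x : ℚ_[p]}
    (h : IsPow 2 (1 + (p : ℚ_[p]) ^ (2 * n + 1) * x ^ 2)) :
    ‖(p : ℚ_[p]) ^ (2 * n + 1) * x ^ 2‖ ≤ 1 := by
  have hp : (p : ℚ_[p]) ≠ 0 := by exact_mod_cast (Fact.out : p.Prime).ne_zero
  by_contra! hlt
  have hne : (p : ℚ_[p]) ^ (2 * n + 1) * x ^ 2 ≠ 0 := norm_pos_iff.1 (zero_lt_one.trans hlt)
  have hx : x ≠ 0 := by rintro rfl; simp at hne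
  obtain ⟨y, hy, he⟩ := h
  have h1 : ‖y ^ 2‖ = ‖(p : ℚ_[p]) ^ (2 * n + 1) * x ^ 2‖ := by
    rw [he, add_eq_max_of_ne, norm_one, max_eq_right hlt.le]
    rw [norm_one]
    exact hlt.ne
  rw [norm_eq_zpow_neg_valuation (pow_ne_zero _ hy), norm_eq_zpow_neg_valuation hne,
    zpow_right_inj₀ (by exact_mod_cast (Fact.out : p.Prime).pos)
      (by exact_mod_cast (Fact.out : p.Prime).one_lt.ne'), valuation_mul (pow_ne_zero _ hp)
      (pow_ne_zero _ hx), valuation_pow, valuation_pow, valuation_pow, valuation_p] at h1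
  push_cast at h1
  omega

/-- A version of Hensel's lemma for polynomials with small higher coefficients. -/
theorem exists_root_of_small (r : ℝ) (d : ℕ) : ∃ ε > 0, ∃ B : ℝ, ∀ a : ℕ → ℚ_[p], ‖a 0‖ ≤ r →
    a 1 = 1 → (∀ i ∈ Finset.Ico 2 (d + 2), ‖a i‖ < ε) →
    ∃ u, ‖u‖ ≤ B ∧ ∑ i ∈ Finset.range (d + 2), a i * u ^ i = 0 := by
  obtain ⟨c, hc⟩ := NormedField.exists_lt_norm ℚ_[p] (max r 1)
  obtain ⟨hcr, hc1⟩ := max_lt_iff.1 hc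
  have hc0 : 0 < ‖c‖ := zero_lt_one.trans hc1
  have hcne := norm_pos_iff.1 hc0
  refine ⟨(‖c‖ ^ (d + 1))⁻¹, by positivity, ‖c‖, fun a h0 h1 h2 => ?_⟩
  have hb : ∀ i ∈ Finset.range (d + 2), i ≠ 1 → ‖a i * c ^ i / c‖ < 1 := fun i hi hi1 => by
    rw [norm_div, div_lt_one hc0, norm_mul, norm_pow]
    rcases Nat.eq_zero_or_pos i with rfl | hpos
    · simpa using h0.trans_lt hcr
    · have hi' : i ∈ Finset.Ico 2 (d + 2) := by simp at hi ⊢; omega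
      calc ‖a i‖ * ‖c‖ ^ i < (‖c‖ ^ (d + 1))⁻¹ * ‖c‖ ^ i := by
            gcongr
            exact h2 i hi'
        _ ≤ (‖c‖ ^ (d + 1))⁻¹ * ‖c‖ ^ (d + 1) := by
            gcongr
            · exact hc1.le
            · simp at hi; omega
        _ = 1 := inv_mul_cancel₀ (by positivity)
        _ < ‖c‖ := hc1
  have hb1 : a 1 * c ^ 1 / c = 1 := by rw [h1, pow_one, one_mul, div_self hcne]
  have hle : ∀ i ∈ Finset.range (d + 2), ‖a i * c ^ i / c‖ ≤ 1 := fun i hi => by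
    by_cases h : i = 1
    · subst h; rw [hb1, norm_one]
    · exact (hb i hi h).le
  have hex : ∀ i, ∃ b : ℤ_[p], i ∈ Finset.range (d + 2) → (b : ℚ_[p]) = a i * c ^ i / c :=
    fun i => by
      by_cases hi : i ∈ Finset.range (d + 2)
      · exact ⟨⟨_, hle i hi⟩, fun _ => rfl⟩
      · exact ⟨0, fun h => (hi h).elim⟩
  choose b hbe using hex
  have hb1' : b 1 = 1 := by
    apply Subtype.ext
    rw [hbe 1 (by simp), hb1]
    rfl
  let F : ℤ_[p][X] := ∑ i ∈ Finset.range (d + 2), C (b i) * X ^ i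
  have hcoeff : ∀ i, F.coeff i = if i ∈ Finset.range (d + 2) then b i else 0 := fun i => by
    simp [F, finsetSum_coeff]
  have hF0 : ‖F.aeval (0 : ℤ_[p])‖ < ‖F.derivative.aeval (0 : ℤ_[p])‖ ^ 2 := by
    rw [coe_aeval_eq_eval, ← coeff_zero_eq_eval_zero, ← coeff_zero_eq_eval_zero, coeff_derivative,
      hcoeff, hcoeff, if_pos (by simp), if_pos (by simp), zero_add, hb1']
    simp only [Nat.cast_zero, zero_add, mul_one, norm_one, one_pow]
    rw [PadicInt.norm_def, hbe 0 (by simp)]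
    exact hb 0 (by simp) (by simp)
  obtain ⟨z, hz, -⟩ := hensels_lemma hF0
  refine ⟨c * z, ?_, ?_⟩
  · rw [norm_mul]
    exact mul_le_of_le_one_right hc0.le z.2
  · have h3 : ∑ i ∈ Finset.range (d + 2), (b i : ℚ_[p]) * (z : ℚ_[p]) ^ i = 0 := by
      have := congrArg (fun w : ℤ_[p] => (w : ℚ_[p])) hz
      simpa [F, coe_aeval_eq_eval, eval_finsetSum] using this
    rw [← mul_zero c, ← h3, Finset.mul_sum]
    refine Finset.sum_congr rfl fun i hi => ?_
    rw [hbe i hi, mul_pow]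
    field_simp

end Padic

namespace Filter.Germ

variable {I K : Type*} (U : Ultrafilter I) [Field K]

/-- The embedding of a field into its ultrapower. -/
noncomputable instance : Algebra K (Germ (U : Filter I) K) :=
  ((coeRingHom (U : Filter I)).comp (Pi.constRingHom I K)).toAlgebra

variable {U}

theorem algebraMap_eq (c : K) :
    algebraMap K (Germ (U : Filter I) K) c = ((fun _ => c : I → K) : Germ (U : Filter I) K) := rfl

theorem coeRingHom_apply (f : I → K) : coeRingHom (U : Filter I) f = (f : Germ (U : Filter I) K) :=
  rfl

theorem coe_eq_zero_iff {f : I → K} : (f : Germ (U : Filter I) K) = 0 ↔ ∀ᶠ i in U, f i = 0 :=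
  coe_eq

theorem isPow_coe_iff {N : ℕ} {f : I → K} :
    IsPow N (f : Germ (U : Filter I) K) ↔ ∀ᶠ i in U, IsPow N (f i) := by
  constructor
  · rintro ⟨y, hy, he⟩
    induction y using inductionOn with | _ y
    rw [Ne, coe_eq_zero_iff, ← Ultrafilter.eventually_not] at hy
    rw [← coe_pow, coe_eq] at he
    filter_upwards [hy, he] with i h1 h2 using ⟨_, h1, h2⟩
  · intro h
    choose! y hy using fun i (hi : IsPow N (f i)) => hi
    refine ⟨(y : Germ (U : Filter I) K), ?_, ?_⟩
    · rw [Ne, coe_eq_zero_iff, ← Ultrafilter.eventually_not]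
      filter_upwards [h] with i hi using (hy i hi).1
    · rw [← coe_pow, coe_eq]
      filter_upwards [h] with i hi using (hy i hi).2

end Filter.Germ

namespace Filter.Germ

variable {I K : Type*} (U : Ultrafilter I) [NormedField K]

/-- The valuation ring of finite elements of an ultrapower of a normed field. -/
def finiteSubring : ValuationSubring (Germ (U : Filter I) K) where
  carrier := {x | ∃ C : ℝ, x.LiftPred fun a => ‖a‖ ≤ C}
  mul_mem' := by
    rintro x y ⟨C, hx⟩ ⟨D, hy⟩
    induction x, y using inductionOn₂ with | _ x y
    refine ⟨C * D, ?_⟩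
    rw [← coe_mul]
    filter_upwards [hx, hy] with i h1 h2
    rw [Pi.mul_apply, norm_mul]
    exact mul_le_mul h1 h2 (norm_nonneg _) ((norm_nonneg _).trans h1)
  one_mem' := ⟨1, Eventually.of_forall fun _ => norm_one.le⟩
  add_mem' := by
    rintro x y ⟨C, hx⟩ ⟨D, hy⟩
    induction x, y using inductionOn₂ with | _ x y
    refine ⟨C + D, ?_⟩
    rw [← coe_add]
    filter_upwards [hx, hy] with i h1 h2
    exact (norm_add_le _ _).trans (add_le_add h1 h2)
  zero_mem' := ⟨0, Eventually.of_forall fun _ => norm_zero.le⟩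
  neg_mem' := by
    rintro x ⟨C, hx⟩
    induction x using inductionOn with | _ x
    refine ⟨C, ?_⟩
    rw [← coe_neg]
    filter_upwards [hx] with i h1
    rwa [Pi.neg_apply, norm_neg]
  mem_or_inv_mem' := fun x => by
    induction x using inductionOn with | _ x
    by_cases h : ∀ᶠ i in U, ‖x i‖ ≤ 1
    · exact Or.inl ⟨1, h⟩
    · refine Or.inr ⟨1, ?_⟩
      rw [← Ultrafilter.eventually_not] at h
      rw [← coe_inv]
      filter_upwards [h] with i hi
      rw [Pi.inv_apply, norm_inv]
      exact inv_le_one_of_one_le₀ (not_le.1 hi).le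

variable {U}

theorem valuation_le_one_iff {f : I → K} :
    (finiteSubring U).valuation (f : Germ (U : Filter I) K) ≤ 1 ↔
      ∃ C : ℝ, ∀ᶠ i in U, ‖f i‖ ≤ C :=
  ValuationSubring.valuation_le_one_iff _ _

theorem valuation_lt_one_iff {f : I → K} :
    (finiteSubring U).valuation (f : Germ (U : Filter I) K) < 1 ↔
      ∀ ε > 0, ∀ᶠ i in U, ‖f i‖ < ε := by
  by_cases h0 : (f : Germ (U : Filter I) K) = 0
  · simp only [h0, map_zero, zero_lt_one, true_iff]
    intro ε hε
    filter_upwards [coe_eq_zero_iff.1 h0] with i hi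
    simpa [hi] using hε
  have hv := ((finiteSubring U).valuation.pos_iff).2 h0
  rw [← not_le, ← inv_le_one₀ hv, ← map_inv₀, ← coe_inv, valuation_le_one_iff]
  rw [not_exists]
  simp_rw [← Ultrafilter.eventually_not, not_le, Pi.inv_apply, norm_inv]
  constructor
  · intro h ε hε
    filter_upwards [h ε⁻¹] with i hi
    have hpos : 0 < ‖f i‖ := inv_pos.1 ((inv_pos.2 hε).trans hi)
    exact (inv_lt_inv₀ hε hpos).1 hi
  · intro h C
    rw [coe_eq_zero_iff, ← Ultrafilter.eventually_not] at h0
    filter_upwards [h0, h (|C| + 1)⁻¹ (by positivity)] with i h1 h2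
    have := (lt_inv_comm₀ (norm_pos_iff.2 h1) (by positivity)).1 h2
    linarith [le_abs_self C]

end Filter.Germ

section Padic

open Filter.Germ

variable {I : Type*} {p : ℕ} [Fact p.Prime]

/-- Every ultrapower of `ℚ_p`, with the valuation whose ring consists of the finite elements,
is coarsely henselian over `ℚ_p`. -/
theorem coarseHenselian_germ (U : Ultrafilter I) :
    CoarseHenselian ℚ_[p] (finiteSubring (K := ℚ_[p]) U).valuation := by
  have hp : (p : ℚ_[p]) ≠ 0 := by exact_mod_cast (Fact.out : p.Prime).ne_zero
  have hconst : ∀ c : ℚ_[p], c ≠ 0 →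
      (finiteSubring (K := ℚ_[p]) U).valuation (algebraMap ℚ_[p] _ c) = 1 := fun c hc => by
    refine le_antisymm (valuation_le_one_iff.2 ⟨‖c‖, by simp⟩) (not_lt.1 fun h => ?_)
    obtain ⟨i, hi⟩ := (valuation_lt_one_iff.1 h ‖c‖ (norm_pos_iff.2 hc)).exists
    exact lt_irrefl _ hi
  have hpow : ∀ N > 0, ∀ x : Germ (U : Filter I) ℚ_[p], x ≠ 0 →
      ∃ c : ℚ_[p], c ≠ 0 ∧ IsPow N (algebraMap ℚ_[p] _ c * x) := fun N hN x hx => by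
    induction x using inductionOn with | _ x
    obtain ⟨S, hS⟩ := Padic.exists_finset_isPow_mul (p := p) hN
    rw [Ne, coe_eq_zero_iff, ← Ultrafilter.eventually_not] at hx
    have h1 : ∀ᶠ i in U, ∃ c ∈ S, IsPow N (c * x i) := hx.mono fun i hi => hS _ hi
    obtain ⟨c, hc, h2⟩ := (Ultrafilter.eventually_exists_mem_iff S.finite_toSet).1 h1
    have h3 : IsPow N (algebraMap ℚ_[p] (Germ (U : Filter I) ℚ_[p]) c * x) := by
      rw [algebraMap_eq, ← coe_mul, isPow_coe_iff]
      exact h2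
    refine ⟨c, ?_, h3⟩
    rintro rfl
    exact h3.ne_zero (by simp)
  refine ⟨hconst, ValuationSubring.valuation_surjective _, fun x hx => ?_, fun d e h0 h1 h2 => ?_,
    fun N hN z hz => ?_, hpow, fun N hN e => ?_, fun n => (p : ℚ_[p]) ^ (2 * n + 1), fun x => ?_⟩
  · induction x using inductionOn with | _ x
    obtain ⟨C, hC⟩ := valuation_le_one_iff.1 hx
    obtain ⟨c, -, hc⟩ := isCompact_iff_ultrafilter_le_nhds.1 (isCompact_closedBall (0 : ℚ_[p]) C)
      (U.map x) (by
        rw [Ultrafilter.coe_map, le_principal_iff, mem_map]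
        filter_upwards [hC] with i hi
        simpa using hi)
    refine ⟨c, ?_⟩
    rw [algebraMap_eq, ← coe_sub, valuation_lt_one_iff]
    intro ε hε
    have := hc (Metric.ball_mem_nhds c hε)
    filter_upwards [this] with i hi
    simpa [dist_eq_norm] using hi
  · choose e' he' using fun i => Quotient.exists_rep (e i)
    obtain rfl : e = fun i => (e' i : Germ (U : Filter I) ℚ_[p]) := funext fun i => (he' i).symm
    obtain ⟨C, hC⟩ := valuation_le_one_iff.1 h0
    obtain ⟨ε, hε, B, hB⟩ := Padic.exists_root_of_small (p := p) C d
    have h2' : ∀ᶠ i in U, ∀ j ∈ Finset.Ico 2 (d + 2), ‖e' j i‖ < ε :=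
      (eventually_all_finset _).2 fun j hj =>
        valuation_lt_one_iff.1 (h2 j (Finset.mem_Ico.1 hj).1) ε hε
    have h3 : ∀ᶠ i in U, ∃ u, ‖u‖ ≤ B ∧ ∑ j ∈ Finset.range (d + 2), e' j i * u ^ j = 0 := by
      filter_upwards [hC, coe_eq.1 h1, h2'] with i g0 g1 g2
      exact hB (fun j => e' j i) g0 g1 g2
    choose! u hu using fun i (hi : ∃ u, ‖u‖ ≤ B ∧
      ∑ j ∈ Finset.range (d + 2), e' j i * u ^ j = 0) => hi
    refine ⟨(u : Germ (U : Filter I) ℚ_[p]), valuation_le_one_iff.2 ⟨B, ?_⟩, ?_⟩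
    · filter_upwards [h3] with i hi using (hu i hi).1
    · simp_rw [← coe_pow, ← coe_mul, ← coeRingHom_apply, ← map_sum]
      rw [coeRingHom_apply, coe_eq_zero_iff]
      filter_upwards [h3] with i hi
      simpa using (hu i hi).2
  · induction z using inductionOn with | _ z
    obtain ⟨ε, hε, h⟩ := IsPow.exists_ball (K := ℚ_[p]) hN
    rw [← coe_one, ← coe_add, isPow_coe_iff]
    filter_upwards [valuation_lt_one_iff.1 hz ε hε] with i hi using h _ hi
  · by_cases he : e = 0
    · exact ⟨0, by simp [he, hN.ne']⟩
    obtain ⟨c, hc, y, hy, h⟩ := hpow N hN e he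
    exact ⟨y, by rw [← map_pow, h, map_mul, hconst c hc, one_mul]⟩
  · induction x using inductionOn with | _ x
    have key : ∀ n : ℕ, IsPow 2 (1 + algebraMap ℚ_[p] (Germ (U : Filter I) ℚ_[p])
        ((p : ℚ_[p]) ^ (2 * n + 1)) * (x : Germ (U : Filter I) ℚ_[p]) ^ 2) ↔
        ∀ᶠ i in U, IsPow 2 (1 + (p : ℚ_[p]) ^ (2 * n + 1) * x i ^ 2) := fun n => by
      rw [algebraMap_eq, ← coe_pow, ← coe_mul, ← coe_one, ← coe_add, isPow_coe_iff]
      rfl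
    simp_rw [key, valuation_le_one_iff]
    have hpn : ∀ n : ℕ, 0 < ‖(p : ℚ_[p]) ^ n‖ := fun n => norm_pos_iff.2 (pow_ne_zero _ hp)
    constructor
    · rintro ⟨C, hC⟩
      obtain ⟨ε, hε, h⟩ := IsPow.exists_ball (K := ℚ_[p]) two_pos
      obtain ⟨n, hn⟩ := exists_pow_lt_of_lt_one (y := ‖(p : ℚ_[p])‖)
        (show 0 < ε / (C ^ 2 + 1) by positivity) Padic.norm_p_lt_one
      refine ⟨n, hC.mono fun i hi => h _ ?_⟩
      rw [norm_mul, norm_pow, norm_pow]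
      calc ‖(p : ℚ_[p])‖ ^ (2 * n + 1) * ‖x i‖ ^ 2 ≤ ‖(p : ℚ_[p])‖ ^ n * (C ^ 2 + 1) := by
            refine mul_le_mul ?_ (by nlinarith [norm_nonneg (x i)]) (by positivity) (by positivity)
            exact pow_le_pow_of_le_one (norm_nonneg _) Padic.norm_p_lt_one.le (by omega)
        _ < ε := (lt_div_iff₀ (by positivity)).1 hn
    · rintro ⟨n, hn⟩
      refine ⟨1 + ‖(p : ℚ_[p]) ^ (2 * n + 1)‖⁻¹, hn.mono fun i hi => ?_⟩
      have h1 := Padic.norm_sq_le_of_isPow hi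
      rw [norm_mul, mul_comm, ← le_div_iff₀ (hpn _), one_div, norm_pow] at h1
      nlinarith [norm_nonneg (x i)]

end Padic

section PowDetermined

open MvPolynomial

variable {K : Type*} [Field K] {ι κ : Type*}

/-- A set is power-determined if membership of `x` only depends on the truth values of finitely
many conditions of the form `IsPow N (f x)` with polynomials `f`. -/
def PowDetermined (S : Set (ι → K)) : Prop :=
  ∃ Φ : Finset (MvPolynomial ι K × ℕ+), ∀ x x' : ι → K,
    (∀ f ∈ Φ, IsPow f.2 (eval x f.1) ↔ IsPow f.2 (eval x' f.1)) → x ∈ S → x' ∈ S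

namespace PowDetermined

theorem compl {S : Set (ι → K)} (hS : PowDetermined S) : PowDetermined Sᶜ := by
  obtain ⟨Φ, h⟩ := hS
  exact ⟨Φ, fun x x' hx hxS hx' => hxS (h x' x (fun f hf => (hx f hf).symm) hx')⟩

theorem union {S T : Set (ι → K)} (hS : PowDetermined S) (hT : PowDetermined T) :
    PowDetermined (S ∪ T) := by
  classical
  obtain ⟨Φ, h⟩ := hS
  obtain ⟨Ψ, h'⟩ := hT
  refine ⟨Φ ∪ Ψ, fun x x' hx => Or.imp (h x x' fun f hf => ?_) (h' x x' fun f hf => ?_)⟩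
  · exact hx f (Finset.mem_union_left _ hf)
  · exact hx f (Finset.mem_union_right _ hf)

theorem empty : PowDetermined (∅ : Set (ι → K)) := ⟨∅, fun _ _ _ h => h⟩

theorem setOf_eval_eq (f g : MvPolynomial ι K) :
    PowDetermined {x : ι → K | eval x f = eval x g} := by
  refine ⟨{(f - g, 1)}, fun x x' h => ?_⟩
  have := h _ (Finset.mem_singleton_self _)
  simp only [PNat.one_coe, IsPow.one_iff, map_sub, not_iff_not, sub_eq_zero, Ne] at this
  exact this.1

theorem preimage_comp {S : Set (ι → K)} (hS : PowDetermined S) (e : ι → κ) :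
    PowDetermined {x : κ → K | x ∘ e ∈ S} := by
  classical
  obtain ⟨Φ, h⟩ := hS
  refine ⟨Φ.image fun f => (rename e f.1, f.2), fun x x' hx => h _ _ fun f hf => ?_⟩
  simpa only [eval_rename] using hx _ (Finset.mem_image_of_mem _ hf)

end PowDetermined

theorem MvPolynomial.aeval_optionElim {E : Type*} [CommRing E] [Algebra K E] (x : ι → E) (t : E)
    (f : MvPolynomial (Option ι) K) :
    aeval (fun o => Option.elim o t x) f =
      ((optionEquivLeft K ι f).map (aeval x : MvPolynomial ι K →ₐ[K] E).toRingHom).eval t := by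
  induction f using MvPolynomial.induction_on with
  | C a => simp
  | add f g hf hg => simp [hf, hg]
  | mul_X f o hf => cases o <;> simp [hf]

theorem MvPolynomial.aeval_germ {I : Type*} (U : Ultrafilter I) (x : I → ι → K)
    (f : MvPolynomial ι K) :
    aeval (fun j => ((fun i => x i j : I → K) : Germ (U : Filter I) K)) f =
      ((fun i => eval (x i) f : I → K) : Germ (U : Filter I) K) := by
  induction f using MvPolynomial.induction_on with
  | C a => simp [Germ.algebraMap_eq]
  | add f g hf hg =>
    simp only [map_add, hf, hg]
    rfl
  | mul_X f o hf =>
    simp only [map_mul, hf, aeval_X, eval_X]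
    rfl

theorem Ultrafilter.eventually_iff_congr {I : Type*} {U : Ultrafilter I} {P Q : I → Prop} :
    (∀ᶠ i in U, (P i ↔ Q i)) ↔ ((∀ᶠ i in U, P i) ↔ ∀ᶠ i in U, Q i) := by
  simp only [iff_def, Filter.eventually_and, Ultrafilter.eventually_imp]

/-- **Quantifier elimination** for `p`-adic fields: projections of power-determined sets are
power-determined. -/
theorem PowDetermined.exists_option {p : ℕ} [Fact p.Prime] {S : Set (Option ι → ℚ_[p])}
    (hS : PowDetermined S) :
    PowDetermined {x : ι → ℚ_[p] | ∃ t, (fun o => Option.elim o t x) ∈ S} := by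
  classical
  obtain ⟨Φ, hΦ⟩ := hS
  by_contra hcon
  unfold PowDetermined at hcon
  push Not at hcon
  choose x x' hxx' hx hx' using hcon
  choose t ht using hx
  let U : Ultrafilter (Finset (MvPolynomial ι ℚ_[p] × ℕ+)) := Ultrafilter.of atTop
  let E := Germ (U : Filter (Finset (MvPolynomial ι ℚ_[p] × ℕ+))) ℚ_[p]
  let X : ι → E := fun j => ((fun Ψ => x Ψ j : _ → ℚ_[p]) : E)
  let X' : ι → E := fun j => ((fun Ψ => x' Ψ j : _ → ℚ_[p]) : E)
  let ψ : MvPolynomial ι ℚ_[p] →ₐ[ℚ_[p] ] E × E := (aeval X).prod (aeval X')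
  have hG₀ : Matches ψ.range := by
    rintro _ ⟨f, rfl⟩ N hN
    change IsPow N (aeval X f) ↔ IsPow N (aeval X' f)
    rw [aeval_germ, aeval_germ, Germ.isPow_coe_iff, Germ.isPow_coe_iff,
      ← Ultrafilter.eventually_iff_congr]
    refine (Ultrafilter.of_le _) ?_
    filter_upwards [mem_atTop ({(f, ⟨N, hN⟩)} : Finset (MvPolynomial ι ℚ_[p] × ℕ+))] with Ψ hΨ
    exact hxx' Ψ _ (Finset.singleton_subset_iff.1 hΨ)
  obtain ⟨G, hG, hmax⟩ := exists_maximal_matches hG₀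
  let θ : MvPolynomial ι ℚ_[p] →+* G :=
    (ψ.codRestrict G fun f => hG ⟨f, rfl⟩).toRingHom
  obtain ⟨T', hT'⟩ := hmax.exists_match (coarseHenselian_germ U) (t : E)
    (Φ.image fun f => ((optionEquivLeft ℚ_[p] ι f.1).map θ, f.2))
  induction T' using Germ.inductionOn with | _ t'
  have key : ∀ f ∈ Φ, ∀ᶠ Ψ in U, (IsPow f.2 (eval (fun o => Option.elim o (t Ψ) (x Ψ)) f.1) ↔
      IsPow f.2 (eval (fun o => Option.elim o (t' Ψ) (x' Ψ)) f.1)) := fun f hf => by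
    have h := hT' _ (Finset.mem_image_of_mem _ hf)
    have h1 : (fstHom G).comp θ = (aeval X : MvPolynomial ι ℚ_[p] →ₐ[ℚ_[p] ] E).toRingHom := rfl
    have h2 : (sndHom G).comp θ = (aeval X' : MvPolynomial ι ℚ_[p] →ₐ[ℚ_[p] ] E).toRingHom := rfl
    have h3 : ∀ (y : Finset (MvPolynomial ι ℚ_[p] × ℕ+) → ι → ℚ_[p])
        (s : Finset (MvPolynomial ι ℚ_[p] × ℕ+) → ℚ_[p]),
        (fun o => Option.elim o (s : E) fun j => ((fun Ψ => y Ψ j : _ → ℚ_[p]) : E)) =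
        fun o => ((fun Ψ => Option.elim o (s Ψ) (y Ψ) : _ → ℚ_[p]) : E) := fun y s => by
      ext o
      cases o <;> rfl
    rw [Polynomial.map_map, Polynomial.map_map, h1, h2, ← aeval_optionElim, ← aeval_optionElim,
      h3, h3, aeval_germ, aeval_germ, Germ.isPow_coe_iff, Germ.isPow_coe_iff,
      ← Ultrafilter.eventually_iff_congr] at h
    exact h
  obtain ⟨Ψ, h⟩ := ((eventually_all_finset _).2 key).exists
  exact hx' Ψ ⟨t' Ψ, hΦ _ _ h (ht Ψ)⟩

theorem exists_eval_eq_realize {p : ℕ} [Fact p.Prime] {A : Set ℚ_[p]}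
    (τ : (Language.ring[[A]]).Term ι) :
    ∃ f : MvPolynomial ι ℚ_[p], ∀ v : ι → ℚ_[p], τ.realize v = eval v f := by
  induction τ with
  | var i => exact ⟨X i, fun v => by simp⟩
  | @func l g ts ih =>
    choose f hf using ih
    rcases g with g | g
    · cases g with
      | add => exact ⟨f 0 + f 1, fun v => by
          rw [map_add, ← hf, ← hf]; rfl⟩
      | mul => exact ⟨f 0 * f 1, fun v => by
          rw [map_mul, ← hf, ← hf]; rfl⟩
      | neg => exact ⟨-f 0, fun v => by
          rw [map_neg, ← hf]; rfl⟩
      | zero => exact ⟨0, fun v => by rw [map_zero]; rfl⟩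
      | one => exact ⟨1, fun v => by rw [map_one]; rfl⟩
    · cases l with
      | zero =>
        refine ⟨C (g : A), fun v => ?_⟩
        rw [eval_C]
        rfl
      | succ l => exact PEmpty.elim g

theorem powDetermined_realize {p : ℕ} [Fact p.Prime] {A : Set ℚ_[p]} {n : ℕ}
    (φ : (Language.ring[[A]]).BoundedFormula ι n) :
    PowDetermined {w : ι ⊕ Fin n → ℚ_[p] | φ.Realize (w ∘ Sum.inl) (w ∘ Sum.inr)} := by
  induction φ with
  | falsum => exact .empty
  | @equal n t₁ t₂ =>
    obtain ⟨f, hf⟩ := exists_eval_eq_realize t₁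
    obtain ⟨g, hg⟩ := exists_eval_eq_realize t₂
    have := PowDetermined.setOf_eval_eq f g
    simp_rw [← hf, ← hg] at this
    simpa only [Language.BoundedFormula.Realize, Sum.elim_comp_inl_inr] using this
  | rel R =>
    rcases R with R | R
    · exact Empty.elim R
    · exact Empty.elim R
  | imp φ ψ h1 h2 =>
    convert h1.compl.union h2 using 1
    ext w
    exact imp_iff_not_or
  | @all n φ h =>
    have := ((h.preimage_comp (Sum.elim (some ∘ Sum.inl)
      (Fin.lastCases none (some ∘ Sum.inr)))).compl.exists_option).compl
    convert this using 1
    ext w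
    simp only [Set.mem_ofPred_eq, Set.mem_compl_iff, not_exists, not_not]
    refine forall_congr' fun t => iff_of_eq (congrArg _ ?_)
    ext j
    induction j using Fin.lastCases <;> simp

theorem Set.Definable.powDetermined {p : ℕ} [Fact p.Prime] {A : Set ℚ_[p]} {S : Set (ι → ℚ_[p])}
    (hS : A.Definable Language.ring S) : PowDetermined S := by
  obtain ⟨φ, rfl⟩ := hS
  have := (powDetermined_realize φ).preimage_comp (Sum.elim id Fin.elim0)
  convert this using 1
  ext w
  change φ.Realize w ↔ Language.BoundedFormula.Realize φ w _
  exact iff_of_eq (congrArg (Language.BoundedFormula.Realize φ w) (Subsingleton.elim _ _))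

end PowDetermined

section Resultant

open Polynomial

theorem Polynomial.exists_mul_add_mul_eq_C {A : Type*} [CommRing A] [IsDomain A]
    [UniqueFactorizationMonoid A] {q h : A[X]} (hq : Irreducible q) (hqh : ¬ q ∣ h) :
    ∃ R : A, R ≠ 0 ∧ ∃ a b : A[X], a * q + b * h = C R := by
  by_cases hdeg : q.natDegree = 0
  · obtain ⟨c, rfl⟩ := natDegree_eq_zero.1 hdeg
    exact ⟨c, fun hc => hq.ne_zero (by simp [hc]), 1, 0, by simp⟩
  have hprim := hq.isPrimitive hdeg
  have hinj := Polynomial.map_injective _ (IsFractionRing.injective A (FractionRing A))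
  have hq' := (hprim.irreducible_iff_irreducible_map_fraction_map (K := FractionRing A)).1 hq
  have hqh' := fun hd => hqh (hprim.dvd_of_fraction_map_dvd_fraction_map (K := FractionRing A) hd)
  obtain ⟨a, b, hab⟩ := hq'.coprime_iff_not_dvd.2 hqh'
  obtain ⟨c, hc0, hc⟩ := IsLocalization.integerNormalization_spec (nonZeroDivisors A) a
  obtain ⟨d, hd0, hd⟩ := IsLocalization.integerNormalization_spec (nonZeroDivisors A) b
  refine ⟨c * d, nonZeroDivisors.ne_zero (mul_mem hc0 hd0),
    C d * IsLocalization.integerNormalization (nonZeroDivisors A) a,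
    C c * IsLocalization.integerNormalization (nonZeroDivisors A) b, hinj ?_⟩
  simp only [Polynomial.map_add, Polynomial.map_mul, hc, hd, map_C, Algebra.smul_def,
    Polynomial.algebraMap_apply, map_mul]
  linear_combination (C (algebraMap A (FractionRing A) c) *
    C (algebraMap A (FractionRing A) d)) * hab


end Resultant

section Generic

open MvPolynomial

variable {K : Type*} [Field K] {ι : Type*}

/-- Finitely many properties holding on nonempty Zariski open sets hold simultaneously on one. -/
theorem MvPolynomial.exists_ne_zero_forall_finset {α : Type*} (s : Finset α)
    {P : α → (ι → K) → Prop}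
    (h : ∀ i ∈ s, ∃ R : MvPolynomial ι K, R ≠ 0 ∧ ∀ x, eval x R ≠ 0 → P i x) :
    ∃ R : MvPolynomial ι K, R ≠ 0 ∧ ∀ x, eval x R ≠ 0 → ∀ i ∈ s, P i x := by
  choose! R hR hP using h
  refine ⟨∏ i ∈ s, R i, Finset.prod_ne_zero_iff.2 hR, fun x hx i hi => hP i hi x ?_⟩
  rw [map_prod, Finset.prod_ne_zero_iff] at hx
  exact hx i hi

theorem MvPolynomial.exists_ne_zero_forall_dvd {q : Polynomial (MvPolynomial ι K)}
    (hq : Irreducible q) (h : Polynomial (MvPolynomial ι K)) :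
    ∃ R : MvPolynomial ι K, R ≠ 0 ∧ ∀ x, eval x R ≠ 0 → ∀ y,
      (q.map (eval x)).eval y = 0 → (h.map (eval x)).eval y = 0 → q ∣ h := by
  by_cases hqh : q ∣ h
  · exact ⟨1, one_ne_zero, fun _ _ _ _ _ => hqh⟩
  obtain ⟨R, hR, a, b, hab⟩ := Polynomial.exists_mul_add_mul_eq_C hq hqh
  refine ⟨R, hR, fun x hx y hqy hhy => (hx ?_).elim⟩
  have := congrArg (fun g => (g.map (eval x)).eval y) hab
  simpa [hqy, hhy] using this.symm

theorem MvPolynomial.exists_ne_zero_forall_derivative_ne_zero [CharZero K]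
    {q : Polynomial (MvPolynomial ι K)} (hq : Irreducible q) :
    ∃ R : MvPolynomial ι K, R ≠ 0 ∧ ∀ x, eval x R ≠ 0 → ∀ y,
      (q.map (eval x)).eval y = 0 → (q.derivative.map (eval x)).eval y ≠ 0 := by
  by_cases hdeg : q.natDegree = 0
  · obtain ⟨c, rfl⟩ := Polynomial.natDegree_eq_zero.1 hdeg
    refine ⟨c, fun hc => hq.ne_zero (by simp [hc]), fun x hx y hy => (hx ?_).elim⟩
    simpa using hy
  obtain ⟨R, hR, h⟩ := exists_ne_zero_forall_dvd hq q.derivative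
  refine ⟨R, hR, fun x hx y hqy hqy' => hdeg (Polynomial.derivative_eq_zero.1 ?_)⟩
  exact Polynomial.eq_zero_of_dvd_of_degree_lt (h x hx y hqy hqy')
    (Polynomial.degree_derivative_lt hq.ne_zero)

/-- For generic `x`, any common zero `y` of some members of a finite family of polynomials
is a simple zero of a common divisor of these members. -/
theorem MvPolynomial.exists_ne_zero_forall_simple_root [CharZero K]
    (Ψ : Finset (Polynomial (MvPolynomial ι K))) :
    ∃ R : MvPolynomial ι K, R ≠ 0 ∧ ∀ x, eval x R ≠ 0 →
      ∀ h ∈ Ψ, h ≠ 0 → ∀ y, (h.map (eval x)).eval y = 0 →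
        ∃ q : Polynomial (MvPolynomial ι K), (q.map (eval x)).eval y = 0 ∧
          (q.derivative.map (eval x)).eval y ≠ 0 ∧
          ∀ h' ∈ Ψ, (h'.map (eval x)).eval y = 0 → q ∣ h' := by
  classical
  refine exists_ne_zero_forall_finset Ψ fun h _ => ?_
  by_cases h0 : h = 0
  · exact ⟨1, one_ne_zero, fun _ _ h0' => (h0' h0).elim⟩
  have hirr := UniqueFactorizationMonoid.irreducible_of_factor (a := h)
  obtain ⟨R, hR, hRd⟩ := exists_ne_zero_forall_finset
    (UniqueFactorizationMonoid.factors h).toFinset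
    fun q hq => exists_ne_zero_forall_derivative_ne_zero (hirr q (Multiset.mem_toFinset.1 hq))
  obtain ⟨S, hS, hSd⟩ := exists_ne_zero_forall_finset
    (UniqueFactorizationMonoid.factors h).toFinset
    fun q hq => exists_ne_zero_forall_finset Ψ
      fun h' _ => exists_ne_zero_forall_dvd (hirr q (Multiset.mem_toFinset.1 hq)) h'
  refine ⟨R * S, mul_ne_zero hR hS, fun x hx _ y hy => ?_⟩
  rw [map_mul, mul_ne_zero_iff] at hx
  obtain ⟨u, hu⟩ := UniqueFactorizationMonoid.factors_prod h0
  have hprod : ((UniqueFactorizationMonoid.factors h).map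
      fun q => (q.map (eval x)).eval y).prod = 0 := by
    have h1 := congrArg (fun g => (g.map (eval x)).eval y) hu
    simp only [Polynomial.map_mul, Polynomial.eval_mul, hy, mul_eq_zero] at h1
    have h2 : ((u : Polynomial (MvPolynomial ι K)).map (eval x)).eval y ≠ 0 :=
      (u.isUnit.map ((Polynomial.evalRingHom y).comp (Polynomial.mapRingHom (eval x)))).ne_zero
    rw [← h1.resolve_right h2]
    exact (map_multiset_prod ((Polynomial.evalRingHom y).comp
      (Polynomial.mapRingHom (eval x))) _).symm
  obtain ⟨q, hq, hqy⟩ := Multiset.mem_map.1 (Multiset.prod_eq_zero_iff.1 hprod)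
  rw [← Multiset.mem_toFinset] at hq
  exact ⟨q, hqy, hRd x hx.1 q hq y hqy, fun h' hh' => hSd x hx.2 q hq h' hh' y hqy⟩

end Generic

section Analysis

open MvPolynomial

variable {K : Type*} [NontriviallyNormedField K] {ι : Type*} [Fintype ι]

theorem MvPolynomial.analyticAt_eval_map_eval (G : Polynomial (MvPolynomial ι K))
    (u : (ι → K) × K) :
    AnalyticAt K (fun v : (ι → K) × K => (G.map (eval v.1)).eval v.2) u := by
  have : (fun v : (ι → K) × K => (G.map (eval v.1)).eval v.2) =
      fun v => ∑ i ∈ Finset.range (G.natDegree + 1), eval v.1 (G.coeff i) * v.2 ^ i := by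
    funext v
    rw [Polynomial.eval_eq_sum_range' (Nat.lt_succ_of_le Polynomial.natDegree_map_le)]
    simp
  rw [this]
  refine Finset.analyticAt_fun_sum _ fun i _ => AnalyticAt.mul ?_ (analyticAt_snd.pow i)
  exact AnalyticOnNhd.eval_continuousLinearMap (.fst K (ι → K) K) _ u trivial

/-- Simple zeros of a polynomial extend to strictly differentiable solutions. -/
theorem MvPolynomial.exists_hasStrictFDerivAt_root [CompleteSpace K]
    {G : Polynomial (MvPolynomial ι K)}
    {x₀ : ι → K} {y₀ : K} (h0 : (G.map (eval x₀)).eval y₀ = 0)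
    (h1 : (G.derivative.map (eval x₀)).eval y₀ ≠ 0) :
    ∃ (ξ : (ι → K) → K) (L : (ι → K) →L[K] K), Tendsto ξ (𝓝 x₀) (𝓝 y₀) ∧
      HasStrictFDerivAt ξ L x₀ ∧ ∀ᶠ x in 𝓝 x₀, (G.map (eval x)).eval (ξ x) = 0 := by
  have hG := (analyticAt_eval_map_eval G (x₀, y₀)).hasStrictFDerivAt
  set f' := fderiv K (fun v : (ι → K) × K => (G.map (eval v.1)).eval v.2) (x₀, y₀)
  have hd : f' (0, 1) = (G.derivative.map (eval x₀)).eval y₀ := by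
    have h2 : HasDerivAt (fun y => (G.map (eval x₀)).eval y) (f' (0, 1)) y₀ :=
      hG.hasFDerivAt.comp_hasDerivAt y₀ ((hasDerivAt_const y₀ x₀).prodMk (hasDerivAt_id y₀))
    rw [← Polynomial.derivative_map]
    exact h2.unique (Polynomial.hasDerivAt _ _)
  have hinv : (f' ∘L .inr K (ι → K) K).IsInvertible := by
    rw [← hd] at h1
    refine ⟨ContinuousLinearEquiv.unitsEquivAut K (Units.mk0 _ h1), ?_⟩
    ext
    simp
  refine ⟨hG.implicitFunctionOfProdDomain hinv, _,
    hG.tendsto_implicitFunctionOfProdDomain hinv,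
    hG.hasStrictFDerivAt_implicitFunctionOfProdDomain hinv, ?_⟩
  simpa [h0] using hG.eventually_apply_implicitFunctionOfProdDomain hinv

/-- A function whose graph is power-determined is strictly differentiable at generic points of
its domain. -/
theorem PowDetermined.exists_hasStrictFDerivAt [CompleteSpace K] [CharZero K]
    {Γ : Set (Option ι → K)} (hΓ : PowDetermined Γ) {U : Set (ι → K)} {f : (ι → K) → K}
    (hf : ∀ x y, (fun o => Option.elim o y x) ∈ Γ ↔ x ∈ U ∧ f x = y) :
    ∃ R : MvPolynomial ι K, R ≠ 0 ∧ ∀ x ∈ U, eval x R ≠ 0 →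
      ∃ L : (ι → K) →L[K] K, HasStrictFDerivAt f L x := by
  classical
  obtain ⟨Φ, hΦ⟩ := hΓ
  obtain ⟨R, hR, hroot⟩ := exists_ne_zero_forall_simple_root
    (Φ.image fun g => optionEquivLeft K ι g.1)
  refine ⟨R, hR, fun x₀ hx₀ hRx => ?_⟩
  have hmem : ∀ x y, (∀ g ∈ Φ, IsPow g.2 (((optionEquivLeft K ι g.1).map (eval x₀)).eval (f x₀)) ↔
      IsPow g.2 (((optionEquivLeft K ι g.1).map (eval x)).eval y)) → f x = y := fun x y h =>
    ((hf x y).1 (hΦ _ _ (fun g hg => by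
      simpa only [optionEquivLeft_elim_eval] using h g hg) ((hf x₀ (f x₀)).2 ⟨hx₀, rfl⟩))).2
  have hlocal : ∀ g ∈ Φ, ((optionEquivLeft K ι g.1).map (eval x₀)).eval (f x₀) ≠ 0 →
      ∀ᶠ v in 𝓝 (x₀, f x₀), (IsPow g.2 (((optionEquivLeft K ι g.1).map (eval x₀)).eval (f x₀)) ↔
        IsPow g.2 (((optionEquivLeft K ι g.1).map (eval v.1)).eval v.2)) := fun g _ h0 =>
    ((analyticAt_eval_map_eval (optionEquivLeft K ι g.1)
      (x₀, f x₀)).continuousAt.eventually (IsPow.eventually_iff g.2.pos h0)).mono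
        fun _ h => h.symm
  obtain ⟨h, hh, h0, hh0⟩ : ∃ h ∈ Φ.image fun g => optionEquivLeft K ι g.1,
      h ≠ 0 ∧ (h.map (eval x₀)).eval (f x₀) = 0 := by
    by_contra! hcon
    have hev : ∀ᶠ y in 𝓝 (f x₀), f x₀ = y := by
      have := (Filter.eventually_all_finset Φ).2 fun g hg => show ∀ᶠ y in 𝓝 (f x₀),
          (IsPow g.2 (((optionEquivLeft K ι g.1).map (eval x₀)).eval (f x₀)) ↔
            IsPow g.2 (((optionEquivLeft K ι g.1).map (eval x₀)).eval y)) by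
        by_cases hg0 : optionEquivLeft K ι g.1 = 0
        · simp [hg0]
        · exact (Continuous.prodMk_right x₀).continuousAt.eventually
            (hlocal g hg (hcon _ (Finset.mem_image_of_mem _ hg) hg0))
      exact this.mono fun y hy => hmem x₀ y hy
    obtain ⟨y, hy, hne⟩ := ((hev.filter_mono nhdsWithin_le_nhds).and
      (self_mem_nhdsWithin : {f x₀}ᶜ ∈ 𝓝[≠] (f x₀))).exists
    exact hne hy.symm
  obtain ⟨q, hq0, hq1, hqd⟩ := hroot x₀ hRx h hh h0 _ hh0
  obtain ⟨ξ, L, hξ, hL, hξ0⟩ := exists_hasStrictFDerivAt_root hq0 hq1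
  refine ⟨L, hL.congr_of_eventuallyEq ?_⟩
  have := (Filter.eventually_all_finset Φ).2 fun g hg => show ∀ᶠ x in 𝓝 x₀,
      (IsPow g.2 (((optionEquivLeft K ι g.1).map (eval x₀)).eval (f x₀)) ↔
        IsPow g.2 (((optionEquivLeft K ι g.1).map (eval x)).eval (ξ x))) by
    by_cases hg0 : ((optionEquivLeft K ι g.1).map (eval x₀)).eval (f x₀) = 0
    · obtain ⟨r, hr⟩ := hqd _ (Finset.mem_image_of_mem _ hg) hg0
      filter_upwards [hξ0] with x hx
      rw [hg0, hr]
      simp [hx]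
    · exact (tendsto_id.prodMk_nhds hξ).eventually (hlocal g hg hg0)
  exact this.mono fun x hx => (hmem x _ hx).symm

end Analysis

section Final

open MvPolynomial

theorem MvPolynomial.interior_setOf_eval_eq_zero {K : Type*} [NontriviallyNormedField K]
    {ι : Type*} [Fintype ι] {R : MvPolynomial ι K} (hR : R ≠ 0) :
    interior {x : ι → K | eval x R = 0} = ∅ := by
  refine Set.eq_empty_of_forall_notMem fun x hx => hR ?_
  obtain ⟨ε, hε, hball⟩ := Metric.mem_nhds_iff.1 (mem_interior_iff_mem_nhds.1 hx)
  refine MvPolynomial.funext_set (fun i => Metric.ball (x i) ε)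
    (fun i => infinite_of_mem_nhds (x i) (Metric.ball_mem_nhds _ hε)) fun y hy => ?_
  rw [map_zero]
  exact hball (by rwa [ball_pi _ hε])

variable {p : ℕ} [Fact p.Prime] {ι κ : Type*}

theorem definable_setOf_eval_ne_zero (R : MvPolynomial ι ℚ_[p]) :
    (Set.univ : Set ℚ_[p]).Definable Language.ring {x : ι → ℚ_[p] | eval x R ≠ 0} := by
  let := FirstOrder.Ring.compatibleRingOfRing ℚ_[p]
  have := ((FirstOrder.Ring.mvPolynomial_zeroLocus_definable {R}).mono (Set.subset_univ _)).compl
  rw [Finset.coe_singleton, zeroLocus_span] at this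
  simpa [Set.compl_ofPred, aeval_eq_eval] using this

theorem HasStrictFDerivAt.tendsto_norm_sub_div {𝕜 E F : Type*} [NontriviallyNormedField 𝕜]
    [NormedAddCommGroup E] [NormedSpace 𝕜 E] [NormedAddCommGroup F] [NormedSpace 𝕜 F]
    {f : E → F} {A : E →L[𝕜] F} {a : E} (h : HasStrictFDerivAt f A a) :
    Tendsto (fun q : E × E => ‖f q.2 - f q.1 - A (q.2 - q.1)‖ / ‖q.2 - q.1‖) (𝓝 (a, a)) (𝓝 0) :=
  h.isLittleO.norm_norm.tendsto_div_nhds_zero.comp (continuous_swap.tendsto (a, a))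

theorem exists_hasStrictFDerivAt_of_definable [Fintype ι] [Fintype κ] {U : Set (ι → ℚ_[p])}
    {f : (ι → ℚ_[p]) → κ → ℚ_[p]} (hf : (Set.univ : Set ℚ_[p]).Definable Language.ring
      {v : (ι ⊕ κ) → ℚ_[p] | (fun i => v (Sum.inl i)) ∈ U ∧
        f (fun i => v (Sum.inl i)) = fun j => v (Sum.inr j)}) :
    ∃ R : MvPolynomial ι ℚ_[p], R ≠ 0 ∧ ∀ x ∈ U, eval x R ≠ 0 →
      ∃ A : (ι → ℚ_[p]) →L[ℚ_[p] ] (κ → ℚ_[p]), HasStrictFDerivAt f A x := by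
  have hcomp : ∀ j, ∃ R : MvPolynomial ι ℚ_[p], R ≠ 0 ∧ ∀ x, eval x R ≠ 0 → x ∈ U →
      ∃ L : (ι → ℚ_[p]) →L[ℚ_[p] ] ℚ_[p], HasStrictFDerivAt (fun x => f x j) L x := fun j => by
    have hΓ := (hf.image_comp (fun o : Option ι => o.elim (Sum.inr j) Sum.inl)).powDetermined
    obtain ⟨R, hR, h⟩ := hΓ.exists_hasStrictFDerivAt (U := U) (f := fun x => f x j) fun x y => by
      constructor
      · rintro ⟨v, ⟨hvU, hv⟩, hvx⟩
        have hx : (fun i => v (Sum.inl i)) = x := funext fun i => congrFun hvx (some i)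
        have hy : v (Sum.inr j) = y := congrFun hvx none
        rw [hx] at hvU hv
        exact ⟨hvU, (congrFun hv j).trans hy⟩
      · rintro ⟨hx, rfl⟩
        refine ⟨Sum.elim x (f x), ⟨hx, rfl⟩, funext fun o => ?_⟩
        cases o <;> rfl
    exact ⟨R, hR, fun x hx hxU => h x hxU hx⟩
  obtain ⟨R, hR, h⟩ := exists_ne_zero_forall_finset Finset.univ fun j _ => hcomp j
  refine ⟨R, hR, fun x hxU hx => ?_⟩
  choose L hL using fun j => h x hx j (Finset.mem_univ j) hxU
  exact ⟨ContinuousLinearMap.pi L, hasStrictFDerivAt_pi.2 hL⟩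

end Final

/-- **Multivariable generic strict differentiability over `ℚ_p`.**
If `U ⊆ ℚ_p^n` is a nonempty open definable set and `f : ℚ_p^n → ℚ_p^m` has a definable
graph over `U`, then there is a definable open `U₀ ⊆ U` with `U \ U₀` nowhere dense such
that `f` is strictly differentiable at every point of `U₀`. -/
theorem stmt1 (p : ℕ) [Fact p.Prime] (n m : ℕ) (hn : 1 ≤ n) (hm : 1 ≤ m)
    (U : Set (Fin n → ℚ_[p])) (hUne : U.Nonempty) (hUopen : IsOpen U)
    (hUdef : Set.Definable (Set.univ : Set ℚ_[p]) FirstOrder.Language.ring U)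
    (f : (Fin n → ℚ_[p]) → (Fin m → ℚ_[p]))
    (hfdef : Set.Definable (Set.univ : Set ℚ_[p]) FirstOrder.Language.ring
      {v : (Fin n ⊕ Fin m) → ℚ_[p] | (fun i => v (Sum.inl i)) ∈ U ∧
        f (fun i => v (Sum.inl i)) = fun j => v (Sum.inr j)}) :
    ∃ U₀ : Set (Fin n → ℚ_[p]), U₀ ⊆ U ∧ IsOpen U₀ ∧
      Set.Definable (Set.univ : Set ℚ_[p]) FirstOrder.Language.ring U₀ ∧
      interior (closure (U \ U₀)) = ∅ ∧
      ∀ a ∈ U₀, ∃ A : (Fin n → ℚ_[p]) →L[ℚ_[p] ] (Fin m → ℚ_[p]),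
        Filter.Tendsto
          (fun q : (Fin n → ℚ_[p]) × (Fin n → ℚ_[p]) =>
            ‖f q.2 - f q.1 - A (q.2 - q.1)‖ / ‖q.2 - q.1‖)
          (𝓝[{q : (Fin n → ℚ_[p]) × (Fin n → ℚ_[p]) |
            q.1 ∈ U₀ ∧ q.2 ∈ U₀ ∧ q.1 ≠ q.2}] (a, a)) (𝓝 0) := by
  obtain ⟨R, hR, hdiff⟩ := exists_hasStrictFDerivAt_of_definable hfdef
  have hcont : Continuous fun x => MvPolynomial.eval x R := MvPolynomial.continuous_eval R
  refine ⟨U ∩ {x | MvPolynomial.eval x R ≠ 0}, Set.inter_subset_left,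
    hUopen.inter (isOpen_ne_fun hcont continuous_const),
    hUdef.inter (definable_setOf_eval_ne_zero R), ?_, fun a ha => ?_⟩
  · have hsub : closure (U \ (U ∩ {x | MvPolynomial.eval x R ≠ 0})) ⊆
        {x | MvPolynomial.eval x R = 0} :=
      closure_minimal (fun x hx => by_contra fun h => hx.2 ⟨hx.1, h⟩)
        (isClosed_eq hcont continuous_const)
    exact Set.subset_eq_empty (interior_mono hsub) (MvPolynomial.interior_setOf_eval_eq_zero hR)
  · obtain ⟨A, hA⟩ := hdiff a ha.1 ha.2
    exact ⟨A, hA.tendsto_norm_sub_div.mono_left nhdsWithin_le_nhds⟩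
end

section
/- Let p be a prime and n ≥ 1, and endow Fin n → ℤ_p with the supremum norm. Let f : (Fin n → ℤ_p) → (Fin n → ℤ_p) be a strictly contracting map, i.e. ‖f x - f y‖ < ‖x - y‖ for all x ≠ y. Then f has exactly one fixed point: there is a unique x with f x = x. -/
open Filter Topology

/-- **Edelstein's fixed point theorem**: a map of a nonempty compact metric space which strictly
decreases distances has a unique fixed point. -/
theorem existsUnique_fixedPoint_of_dist_lt {X : Type*} [MetricSpace X] [CompactSpace X] [Nonempty X]
    (f : X → X) (hf : ∀ x y : X, x ≠ y → dist (f x) (f y) < dist x y) : ∃! x : X, f x = x := by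
  have hlip : LipschitzWith 1 f := LipschitzWith.of_dist_le_mul fun x y => by
    rcases eq_or_ne x y with rfl | h
    · simp
    · simpa using (hf x y h).le
  obtain ⟨x, -, hx⟩ := isCompact_univ.exists_isMinOn Set.univ_nonempty
    (hlip.continuous.dist continuous_id).continuousOn
  have hfx : f x = x := by
    by_contra h
    exact (hf (f x) x h).not_ge (isMinOn_univ_iff.1 hx (f x))
  refine ⟨x, hfx, fun y hy => ?_⟩
  by_contra h
  have hlt := hf y x h
  rw [hy, hfx] at hlt
  exact hlt.false

/-- **Fixed point of a strictly contracting map on `ℤ_p^n`.**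
A map of `ℤ_p^n` (sup norm) which strictly decreases distances has a unique fixed point. -/
theorem stmt2 (p : ℕ) [Fact p.Prime] (n : ℕ) (hn : 1 ≤ n)
    (f : (Fin n → ℤ_[p]) → (Fin n → ℤ_[p]))
    (hf : ∀ x y : Fin n → ℤ_[p], x ≠ y → ‖f x - f y‖ < ‖x - y‖) :
    ∃! x : Fin n → ℤ_[p], f x = x := by
  exact existsUnique_fixedPoint_of_dist_lt f fun x y h => by
    simpa only [dist_eq_norm] using hf x y h
end

section
/- Let p be a prime and n ≥ 1, and endow Fin n → ℤ_p with the supremum norm. Let f : (Fin n → ℤ_p) → (Fin n → ℤ_p) satisfy ‖f x - f y‖ < ‖x - y‖ for all x ≠ y. Then for every c ∈ (Fin n → ℤ_p) there is exactly one x ∈ (Fin n → ℤ_p) with f x = x - c. -/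
open Filter Topology

/-- **Edelstein's fixed point theorem.** A strictly distance-decreasing self-map of a nonempty
compact metric space has a unique fixed point. -/
theorem existsUnique_isFixedPt_of_dist_lt {X : Type*} [MetricSpace X] [CompactSpace X] [Nonempty X]
    (g : X → X) (hg : ∀ x y, x ≠ y → dist (g x) (g y) < dist x y) :
    ∃! x, Function.IsFixedPt g x := by
  have hlip : LipschitzWith 1 g := LipschitzWith.of_dist_le_mul fun x y => by
    rcases eq_or_ne x y with rfl | h
    · simp
    · simpa using (hg x y h).le
  obtain ⟨x, -, hx⟩ := isCompact_univ.exists_isMinOn Set.univ_nonempty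
    (hlip.continuous.dist continuous_id).continuousOn
  have hfix : g x = x := by
    by_contra h
    exact (hg _ _ h).not_ge (hx (Set.mem_univ (g x)))
  refine ⟨x, hfix, fun y hy => ?_⟩
  by_contra h
  have hlt := hg y x h
  rw [hy.eq, hfix] at hlt
  exact lt_irrefl _ hlt

/-- **Perturbed fixed points of a strictly contracting map on `ℤ_p^n`.**
If `f` strictly decreases distances on `ℤ_p^n` (sup norm), then for every `c` there is a
unique `x` with `f x = x - c`. -/
theorem stmt3 (p : ℕ) [Fact p.Prime] (n : ℕ) (hn : 1 ≤ n)
    (f : (Fin n → ℤ_[p]) → (Fin n → ℤ_[p]))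
    (hf : ∀ x y : Fin n → ℤ_[p], x ≠ y → ‖f x - f y‖ < ‖x - y‖) :
    ∀ c : Fin n → ℤ_[p], ∃! x : Fin n → ℤ_[p], f x = x - c := by
  intro c
  have h := existsUnique_isFixedPt_of_dist_lt (fun x => f x + c) fun x y hxy => by
    simpa [dist_eq_norm] using hf x y hxy
  simpa only [Function.IsFixedPt, eq_sub_iff_add_eq] using h
end

section
/- Let p be a prime. For every a ∈ ℤ and every integer b ≥ 1 there exist an integer n ≥ 1 and a group homomorphism f : P_n → ℚ_pˣ such that (f x)^b = x^a for every x ∈ P_n (an 'a/b-th power map' on P_n). -/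
/-- A `b`-th root of unity in `ℤ_[p]` reducing to `1` modulo `p ^ k` is trivial
when `p ^ k` does not divide `b`. -/
theorem PadicInt.eq_one_of_pow_eq_one_of_toZModPow_eq_one {p : ℕ} [Fact p.Prime] {b k : ℕ}
    (hk : ¬ p ^ k ∣ b) {z : ℤ_[p]} (hz : z ^ b = 1) (h : PadicInt.toZModPow k z = 1) :
    z = 1 := by
  have hmul : (∑ i ∈ Finset.range b, z ^ i) * (z - 1) = 0 := by
    rw [geom_sum_mul, hz, sub_self]
  rcases mul_eq_zero.mp hmul with hsum | hsub
  · refine absurd ?_ hk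
    rw [← ZMod.natCast_eq_zero_iff]
    simpa [h] using congrArg (PadicInt.toZModPow k) hsum
  · exact sub_eq_zero.mp hsub

/-- For every `b ≥ 1` some power `N ≥ 1` kills all `N * b`-torsion in `ℚ_[p]ˣ`. -/
theorem Padic.exists_pow_eq_one_of_pow_mul_eq_one (p : ℕ) [hp : Fact p.Prime] {b : ℕ}
    (hb : 0 < b) : ∃ N : ℕ, 0 < N ∧ ∀ y : ℚ_[p]ˣ, y ^ (N * b) = 1 → y ^ N = 1 := by
  have hN : 0 < (p ^ b).totient := Nat.totient_pos.mpr (pow_pos hp.out.pos b)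
  refine ⟨(p ^ b).totient, hN, fun y hy => ?_⟩
  have hy' : (y : ℚ_[p]) ^ ((p ^ b).totient * b) = 1 := by
    rw [← Units.val_pow_eq_pow_val, hy, Units.val_one]
  have hnorm : ‖(y : ℚ_[p])‖ = 1 := by
    have h := congrArg norm hy'
    rw [norm_pow, norm_one] at h
    exact (pow_eq_one_iff_of_nonneg (norm_nonneg _) (Nat.mul_pos hN hb).ne').mp h
  let u : ℤ_[p]ˣ := PadicInt.mkUnits hnorm
  have hu : (((u : ℤ_[p]) : ℤ_[p]) : ℚ_[p]) = y := PadicInt.mkUnits_eq hnorm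
  have hpow : ((u : ℤ_[p]) ^ (p ^ b).totient) ^ b = 1 := by
    apply Subtype.ext
    push_cast
    rw [hu, ← pow_mul, hy']
  have hred : PadicInt.toZModPow b ((u : ℤ_[p]) ^ (p ^ b).totient) = 1 := by
    have h := congrArg Units.val
      (ZMod.pow_totient (Units.map (PadicInt.toZModPow (p := p) b).toMonoidHom u))
    rw [map_pow]
    exact h
  have h := PadicInt.eq_one_of_pow_eq_one_of_toZModPow_eq_one
    (Nat.not_dvd_of_pos_of_lt hb (Nat.lt_pow_self hp.out.one_lt)) hpow hred
  apply Units.ext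
  have h' := congrArg (fun t : ℤ_[p] => (t : ℚ_[p])) h
  push_cast at h' ⊢
  rwa [hu] at h'

/-- **Existence of rational power maps.**
For every rational exponent `a/b` (`a ∈ ℤ`, `b ≥ 1`) there is `n ≥ 1` and a group
homomorphism `f` from the subgroup `P_n` of `n`-th powers of `ℚ_pˣ` to `ℚ_pˣ` such that
`(f x)^b = x^a` for all `x ∈ P_n`. -/
theorem stmt6 (p : ℕ) [Fact p.Prime] (a b : ℤ) (hb : 1 ≤ b) :
    ∃ n : ℕ, 1 ≤ n ∧
      ∃ f : ↥((powMonoidHom n : ℚ_[p]ˣ →* ℚ_[p]ˣ).range) →* ℚ_[p]ˣ,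
        ∀ x : ↥((powMonoidHom n : ℚ_[p]ˣ →* ℚ_[p]ˣ).range),
          (f x) ^ b = (x : ℚ_[p]ˣ) ^ a := by
  lift b to ℕ using by lia
  have hb' : 0 < b := by exact_mod_cast hb
  obtain ⟨N, hN, hroot⟩ := Padic.exists_pow_eq_one_of_pow_mul_eq_one p hb'
  refine ⟨N * b, Nat.mul_pos hN hb', ?_⟩
  let φ : ℚ_[p]ˣ →* ℚ_[p]ˣ := powMonoidHom (N * b)
  let ψ : ℚ_[p]ˣ →* ℚ_[p]ˣ := (zpowGroupHom a).comp (powMonoidHom N)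
  have hker : φ.rangeRestrict.ker ≤ ψ.ker := by
    intro y hy
    rw [MonoidHom.ker_rangeRestrict, MonoidHom.mem_ker] at hy
    simp [ψ, MonoidHom.mem_ker, hroot y hy]
  let f := φ.rangeRestrict.liftOfSurjective φ.rangeRestrict_surjective ⟨ψ, hker⟩
  refine ⟨f, fun x => ?_⟩
  obtain ⟨y, rfl⟩ := φ.rangeRestrict_surjective x
  have hf : f (φ.rangeRestrict y) = ψ y :=
    φ.rangeRestrict.liftOfRightInverse_comp_apply _ _ ⟨ψ, hker⟩ y
  rw [hf]
  simp only [ψ, φ, MonoidHom.comp_apply, MonoidHom.coe_rangeRestrict, powMonoidHom_apply,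
    zpowGroupHom_apply, ← zpow_natCast, ← zpow_mul]
  congr 1
  push_cast
  ring
end

section
/- Let p be a prime. Let c : ℕ → ℤ_p satisfy ‖c k‖ → 0 as k → ∞, and define f : ℤ_p → ℤ_p by f x = ∑'_k c k · x^k. Then f is strictly differentiable at every a ∈ ℤ_p with strict derivative g a := ∑'_k (k+1) · c (k+1) · a^k: the quotient (f y - f x)/(y - x) tends to g a as (x, y) → (a, a) with x, y ∈ ℤ_p and x ≠ y. Moreover the coefficients k ↦ (k+1) · c (k+1) lie in ℤ_p and their norms tend to 0, so the derivative g is itself pre-splendid. -/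
open Filter Topology

/-- If `‖c k‖ → 0` in `ℤ_[p]` then `∑ c k * u k` converges for every sequence `u` in `ℤ_[p]`. -/
theorem summable_mul_of_tendsto_norm_zero {p : ℕ} [Fact p.Prime] {c : ℕ → ℤ_[p]}
    (hc : Tendsto (fun k => ‖c k‖) atTop (𝓝 0)) (u : ℕ → ℤ_[p]) :
    Summable fun k => c k * u k := by
  refine NonarchimedeanAddGroup.summable_of_tendsto_cofinite_zero ?_
  rw [Nat.cofinite_eq_atTop]
  refine squeeze_zero_norm (fun k => ?_) hc
  rw [norm_mul]
  exact mul_le_of_le_one_right (norm_nonneg _) (PadicInt.norm_le_one _)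

/-- If `‖c k‖ → 0` in `ℤ_[p]` and the functions `u k` are continuous on a compact space, then
`x ↦ ∑' k, c k * u k x` is continuous. -/
theorem continuous_tsum_mul_of_tendsto_norm_zero {p : ℕ} [Fact p.Prime] {X : Type*}
    [TopologicalSpace X] [CompactSpace X] {c : ℕ → ℤ_[p]}
    (hc : Tendsto (fun k => ‖c k‖) atTop (𝓝 0)) (u : ℕ → C(X, ℤ_[p])) :
    Continuous fun x => ∑' k, c k * u k x := by
  have hs : Summable fun k => c k • u k := by
    refine NonarchimedeanAddGroup.summable_of_tendsto_cofinite_zero ?_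
    rw [Nat.cofinite_eq_atTop]
    refine squeeze_zero_norm (fun k => ?_) hc
    refine (ContinuousMap.norm_le _ (norm_nonneg _)).2 fun x => ?_
    rw [ContinuousMap.smul_apply, smul_eq_mul, norm_mul]
    exact mul_le_of_le_one_right (norm_nonneg _) (PadicInt.norm_le_one _)
  have h : (fun x => ∑' k, c k * u k x) = ⇑(∑' k, c k • u k) := by
    funext x
    rw [← ContinuousMap.tsum_apply hs x]
    rfl
  rw [h]
  exact ContinuousMap.continuous _

/-- **Pre-splendid functions are strictly differentiable, with pre-splendid derivative.**
If `f x = ∑' k, c k * x^k` with `‖c k‖ → 0`, then at every `a ∈ ℤ_p` the difference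
quotient `(f y - f x)/(y - x)` (computed in `ℚ_p`) tends to `g a = ∑' k, (k+1) c(k+1) a^k`
as `(x, y) → (a, a)` with `x ≠ y`; moreover the coefficients `(k+1) * c (k+1)` of `g` lie
in `ℤ_p` and tend to `0` in norm, so `g` is pre-splendid. -/
theorem stmt9 (p : ℕ) [Fact p.Prime] (c : ℕ → ℤ_[p])
    (hc : Filter.Tendsto (fun k => ‖c k‖) Filter.atTop (𝓝 0))
    (f : ℤ_[p] → ℤ_[p]) (hf : ∀ x : ℤ_[p], f x = ∑' k : ℕ, c k * x ^ k)
    (d : ℕ → ℤ_[p]) (hd : ∀ k : ℕ, d k = ((k + 1 : ℕ) : ℤ_[p]) * c (k + 1))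
    (g : ℤ_[p] → ℤ_[p]) (hg : ∀ a : ℤ_[p], g a = ∑' k : ℕ, d k * a ^ k) :
    (∀ a : ℤ_[p],
      Filter.Tendsto
        (fun q : ℤ_[p] × ℤ_[p] =>
          ((f q.2 : ℚ_[p]) - (f q.1 : ℚ_[p])) / ((q.2 : ℚ_[p]) - (q.1 : ℚ_[p])))
        (𝓝[{q : ℤ_[p] × ℤ_[p] | q.1 ≠ q.2}] (a, a)) (𝓝 ((g a : ℚ_[p])))) ∧
    Filter.Tendsto (fun k => ‖d k‖) Filter.atTop (𝓝 0) := by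
  have hc' : Tendsto (fun k => ‖c (k + 1)‖) atTop (𝓝 0) := hc.comp (tendsto_add_atTop_nat 1)
  refine ⟨fun a => ?_, ?_⟩
  · let S : ℕ → C(ℤ_[p] × ℤ_[p], ℤ_[p]) := fun k =>
      ⟨fun q => ∑ i ∈ Finset.range (k + 1), q.2 ^ i * q.1 ^ (k + 1 - 1 - i), by fun_prop⟩
    have hS (k : ℕ) (q : ℤ_[p] × ℤ_[p]) :
        S k q * (q.2 - q.1) = q.2 ^ (k + 1) - q.1 ^ (k + 1) :=
      (Commute.all q.2 q.1).geom_sum₂_mul (k + 1)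
    have hSdiag (k : ℕ) : S k (a, a) = ((k + 1 : ℕ) : ℤ_[p]) * a ^ k :=
      geom_sum₂_self a (k + 1)
    have hF := continuous_tsum_mul_of_tendsto_norm_zero hc' S
    have hFa : ∑' k, c (k + 1) * S k (a, a) = g a := by
      rw [hg]
      refine tsum_congr fun k => ?_
      rw [hSdiag, hd]
      ring
    have hfF (q : ℤ_[p] × ℤ_[p]) :
        f q.2 - f q.1 = (∑' k, c (k + 1) * S k q) * (q.2 - q.1) := by
      have hsum (x : ℤ_[p]) := summable_mul_of_tendsto_norm_zero hc fun k => x ^ k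
      have hsum' (x : ℤ_[p]) := summable_mul_of_tendsto_norm_zero hc' fun k => x ^ (k + 1)
      rw [hf, hf, (hsum q.2).tsum_eq_zero_add, (hsum q.1).tsum_eq_zero_add, pow_zero, pow_zero,
        add_sub_add_left_eq_sub, ← (hsum' q.2).tsum_sub (hsum' q.1),
        ← (summable_mul_of_tendsto_norm_zero hc' _).tsum_mul_right]
      refine tsum_congr fun k => ?_
      rw [mul_assoc, hS, mul_sub]
    have hlim : Tendsto (fun q => ((∑' k, c (k + 1) * S k q : ℤ_[p]) : ℚ_[p])) (𝓝 (a, a))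
        (𝓝 (g a : ℚ_[p])) := by
      rw [← hFa]
      exact (continuous_subtype_val.comp hF).tendsto (a, a)
    refine (hlim.mono_left nhdsWithin_le_nhds).congr' ?_
    filter_upwards [self_mem_nhdsWithin] with q hq
    have hne : (q.2 : ℚ_[p]) - q.1 ≠ 0 :=
      sub_ne_zero.2 fun h => hq (Subtype.ext h).symm
    rw [eq_div_iff hne]
    rw [← PadicInt.coe_sub, ← PadicInt.coe_sub, ← PadicInt.coe_mul, hfF]
  · refine squeeze_zero (fun k => norm_nonneg _) (fun k => ?_) hc'
    rw [hd, norm_mul]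
    exact mul_le_of_le_one_left (norm_nonneg _) (PadicInt.norm_le_one _)
end

section
/- Let p be a prime. Let c, d : ℕ → ℤ_p satisfy ‖c k‖ → 0 and ‖d k‖ → 0 as k → ∞, and define f, g : ℤ_p → ℤ_p by f x = ∑'_k c k · x^k and g x = ∑'_k d k · x^k. Then the composition g ∘ f is pre-splendid: there exists e : ℕ → ℤ_p with ‖e k‖ → 0 such that g (f x) = ∑'_k e k · x^k for all x ∈ ℤ_p. -/
open Filter Topology

section Nonarchimedean

variable {R : Type*} [CommRing R] [UniformSpace R] [IsUniformAddGroup R] [NonarchimedeanRing R]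
  [T2Space R]

/-- The Cauchy product formula in a nonarchimedean ring. -/
theorem HasSum.sum_mul_antidiagonal_of_nonarchimedean {f g : ℕ → R} {a b : R} (hf : HasSum f a)
    (hg : HasSum g b) :
    HasSum (fun n => ∑ kl ∈ Finset.HasAntidiagonal.antidiagonal n, f kl.1 * g kl.2) (a * b) := by
  have hfg := hf.summable.mul_of_nonarchimedean hg.summable
  have hsum := (summable_sum_mul_antidiagonal_of_summable_mul hfg).hasSum
  rwa [← hf.summable.tsum_mul_tsum_eq_tsum_sum_antidiagonal hg.summable hfg, hf.tsum_eq,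
    hg.tsum_eq] at hsum

/-- The product of two power series converging at `x` converges at `x` to the product of sums. -/
theorem PowerSeries.hasSum_coeff_mul {A B : PowerSeries R} {x a b : R}
    (hA : HasSum (fun k => PowerSeries.coeff k A * x ^ k) a)
    (hB : HasSum (fun k => PowerSeries.coeff k B * x ^ k) b) :
    HasSum (fun k => PowerSeries.coeff k (A * B) * x ^ k) (a * b) := by
  convert hA.sum_mul_antidiagonal_of_nonarchimedean hB using 2 with k
  rw [PowerSeries.coeff_mul, Finset.sum_mul]
  refine Finset.sum_congr rfl fun ij hij => ?_
  rw [← Finset.HasAntidiagonal.mem_antidiagonal.mp hij, pow_add]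
  ring

/-- The powers of a power series converging at `x` converge at `x` to the powers of the sum. -/
theorem PowerSeries.hasSum_coeff_pow {A : PowerSeries R} {x a : R}
    (hA : HasSum (fun k => PowerSeries.coeff k A * x ^ k) a) (n : ℕ) :
    HasSum (fun k => PowerSeries.coeff k (A ^ n) * x ^ k) (a ^ n) := by
  induction n with
  | zero =>
    convert hasSum_single (f := fun k => PowerSeries.coeff k (A ^ 0) * x ^ k) 0 ?_ using 1
    · simp
    · intro k hk
      simp [PowerSeries.coeff_one, hk]
  | succ n ih => simpa only [pow_succ] using hasSum_coeff_mul ih hA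

end Nonarchimedean

namespace PadicInt

variable {p : ℕ} [Fact p.Prime]

instance : NonarchimedeanRing ℤ_[p] where
  is_nonarchimedean := NonarchimedeanAddGroup.is_nonarchimedean

theorem summable_of_tendsto_cofinite {ι : Type*} {u : ι → ℤ_[p]}
    (hu : Tendsto u cofinite (𝓝 0)) : Summable u :=
  NonarchimedeanAddGroup.summable_of_tendsto_cofinite_zero hu

theorem summable_mul_pow {u : ℕ → ℤ_[p]} (hu : Tendsto (fun k => ‖u k‖) atTop (𝓝 0))
    (x : ℤ_[p]) : Summable fun k => u k * x ^ k := by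
  refine summable_of_tendsto_cofinite ?_
  rw [Nat.cofinite_eq_atTop]
  refine squeeze_zero_norm (fun k => ?_) hu
  rw [norm_mul]
  exact mul_le_of_le_one_right (norm_nonneg _) (norm_le_one _)

/-- A null sequence times a family of null sequences is null along the pairs of indices. -/
theorem tendsto_mul_cofinite {d : ℕ → ℤ_[p]} {a : ℕ → ℕ → ℤ_[p]}
    (hd : Tendsto (fun n => ‖d n‖) atTop (𝓝 0)) (ha : ∀ n, Tendsto (a n) atTop (𝓝 0)) :
    Tendsto (fun i : ℕ × ℕ => d i.1 * a i.1 i.2) cofinite (𝓝 0) := by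
  rw [Metric.tendsto_nhds]
  intro ε hε
  obtain ⟨N, hN⟩ := eventually_atTop.mp (hd.eventually_lt_const hε)
  have hfin (n : ℕ) : {k | ¬ ‖a n k‖ < ε}.Finite := by
    have h := (ha n).norm
    rw [norm_zero, ← Nat.cofinite_eq_atTop] at h
    exact eventually_cofinite.mp (h.eventually_lt_const hε)
  rw [eventually_cofinite]
  refine ((Set.finite_Iio N).biUnion fun n _ =>
    (Set.finite_singleton n).prod (hfin n)).subset ?_
  rintro ⟨n, k⟩ hnk
  simp only [dist_zero_right, norm_mul, Set.mem_ofPred_eq, not_lt] at hnk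
  have hn : n < N := by
    by_contra! h
    exact absurd (hN n h)
      (not_lt.mpr (hnk.trans (mul_le_of_le_one_right (norm_nonneg _) (norm_le_one _))))
  have hk : ¬ ‖a n k‖ < ε :=
    not_lt.mpr (hnk.trans (mul_le_of_le_one_left (norm_nonneg _) (norm_le_one _)))
  exact Set.mem_biUnion (Set.mem_Iio.mpr hn) ⟨rfl, hk⟩

/-- If `a n` are the coefficients of a power series with sum `y n` on `ℤ_[p]`, for each `n`, then
`∑' n, d n * y n` is again the sum of a power series with null coefficients. -/
theorem exists_tsum_mul_tsum_eq {d : ℕ → ℤ_[p]} {a : ℕ → ℕ → ℤ_[p]} {y : ℕ → ℤ_[p] → ℤ_[p]}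
    (hd : Tendsto (fun n => ‖d n‖) atTop (𝓝 0))
    (ha : ∀ n x, HasSum (fun k => a n k * x ^ k) (y n x)) :
    ∃ e : ℕ → ℤ_[p], Tendsto (fun k => ‖e k‖) atTop (𝓝 0) ∧
      ∀ x, ∑' n, d n * y n x = ∑' k, e k * x ^ k := by
  have hsum (x : ℤ_[p]) : Summable fun i : ℕ × ℕ => d i.1 * (a i.1 i.2 * x ^ i.2) :=
    summable_of_tendsto_cofinite
      (tendsto_mul_cofinite (a := fun n k => a n k * x ^ k) hd
        fun n => (ha n x).summable.tendsto_atTop_zero)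
  have hsum_one : Summable fun i : ℕ × ℕ => d i.2 * a i.2 i.1 := by
    have h := (hsum 1).prod_symm
    simpa only [Prod.fst_swap, Prod.snd_swap, one_pow, mul_one] using h
  refine ⟨fun k => ∑' n, d n * a n k, ?_, fun x => ?_⟩
  · simpa using hsum_one.prod.tendsto_atTop_zero.norm
  · calc ∑' n, d n * y n x = ∑' n, ∑' k, d n * (a n k * x ^ k) :=
          tsum_congr fun n => ((ha n x).mul_left (d n)).tsum_eq.symm
      _ = ∑' k, ∑' n, d n * (a n k * x ^ k) :=
          (Summable.tsum_comm (f := fun n k => d n * (a n k * x ^ k)) (hsum x)).symm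
      _ = ∑' k, (∑' n, d n * a n k) * x ^ k := by
          refine tsum_congr fun k => ?_
          rw [← (hsum_one.prod_factor k).tsum_mul_right]
          exact tsum_congr fun n => (mul_assoc _ _ _).symm

end PadicInt

/-- **Composition of pre-splendid functions is pre-splendid.**
If `f x = ∑' k, c k * x^k` and `g x = ∑' k, d k * x^k` with `‖c k‖ → 0` and `‖d k‖ → 0`,
then there is `e : ℕ → ℤ_p` with `‖e k‖ → 0` such that `g (f x) = ∑' k, e k * x^k` for
all `x ∈ ℤ_p`. -/
theorem stmt10 (p : ℕ) [Fact p.Prime] (c d : ℕ → ℤ_[p])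
    (hc : Filter.Tendsto (fun k => ‖c k‖) Filter.atTop (𝓝 0))
    (hd : Filter.Tendsto (fun k => ‖d k‖) Filter.atTop (𝓝 0))
    (f g : ℤ_[p] → ℤ_[p])
    (hf : ∀ x : ℤ_[p], f x = ∑' k : ℕ, c k * x ^ k)
    (hg : ∀ x : ℤ_[p], g x = ∑' k : ℕ, d k * x ^ k) :
    ∃ e : ℕ → ℤ_[p], Filter.Tendsto (fun k => ‖e k‖) Filter.atTop (𝓝 0) ∧
      ∀ x : ℤ_[p], g (f x) = ∑' k : ℕ, e k * x ^ k := by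
  have hA (x : ℤ_[p]) :
      HasSum (fun k => PowerSeries.coeff k (PowerSeries.mk c) * x ^ k) (f x) := by
    simpa only [PowerSeries.coeff_mk, hf x] using (PadicInt.summable_mul_pow hc x).hasSum
  obtain ⟨e, he, hsum⟩ := PadicInt.exists_tsum_mul_tsum_eq hd
    fun n x => PowerSeries.hasSum_coeff_pow (hA x) n
  exact ⟨e, he, fun x => (hg _).trans (hsum x)⟩
end

section
/- Let p be a prime and d ≥ 1. Let c : (Fin d → ℕ) × (Fin d → ℕ) → (Fin d → ℤ_p) be such that for every real r > 0 only finitely many pairs (I, J) satisfy ‖c (I, J)‖ ≥ r, and such that c (I, J) = 0 whenever |I| = 0 or |J| = 0. Define, for x, y ∈ (Fin d → ℤ_p), x ⋆ y = x + y + ∑'_{(I,J)} (x^I · y^J) • c (I, J). Then congruence modulo p^n is respected for every n ∈ ℕ: if x - x' and y - y' have all coordinates in p^n ℤ_p, then (x ⋆ y) - (x' ⋆ y') has all coordinates in p^n ℤ_p. -/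
open Filter Topology

/-- A family of coefficients tending to zero, multiplied termwise by `p`-adic integers, is
summable in each coordinate. -/
theorem summable_mul_apply_of_finite_norm_ge {p : ℕ} [Fact p.Prime] {ι κ : Type*} [Fintype κ]
    {c : ι → κ → ℤ_[p]} (hfin : ∀ r : ℝ, 0 < r → {k | r ≤ ‖c k‖}.Finite)
    (a : ι → ℤ_[p]) (i : κ) : Summable fun k => a k * c k i := by
  apply NonarchimedeanAddGroup.summable_of_tendsto_cofinite_zero
  rw [Metric.tendsto_nhds]
  intro r hr
  refine (hfin r hr).subset fun k hk => ?_
  have hk' : r ≤ ‖a k * c k i‖ := by simpa using hk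
  calc r ≤ ‖a k‖ * ‖c k i‖ := by rwa [← norm_mul]
    _ ≤ 1 * ‖c k‖ := by
      gcongr
      · exact PadicInt.norm_le_one _
      · exact norm_le_pi_norm _ _
    _ = ‖c k‖ := one_mul _

/-- Divisibility by `p ^ n` passes to infinite sums in `ℤ_[p]`. -/
theorem PadicInt.pow_dvd_tsum {p : ℕ} [Fact p.Prime] {ι : Type*} {f : ι → ℤ_[p]} (n : ℕ)
    (h : ∀ k, (p : ℤ_[p]) ^ n ∣ f k) : (p : ℤ_[p]) ^ n ∣ ∑' k, f k := by
  rw [← Ideal.mem_span_singleton, ← PadicInt.norm_le_pow_iff_mem_span_pow]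
  refine IsUltrametricDist.norm_tsum_le_of_forall_le_of_nonneg (by positivity) fun k => ?_
  rw [PadicInt.norm_le_pow_iff_mem_span_pow, Ideal.mem_span_singleton]
  exact h k

/-- Monomials respect congruences. -/
theorem dvd_prod_pow_sub_prod_pow {R κ : Type*} [CommRing R] [Fintype κ] {m : R} {x x' : κ → R}
    (h : ∀ i, m ∣ x i - x' i) (I : κ → ℕ) : m ∣ ∏ j, x j ^ I j - ∏ j, x' j ^ I j := by
  simp only [← Ideal.mem_span_singleton, ← Ideal.Quotient.eq, map_prod, map_pow] at h ⊢
  simp only [h]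

/-- **Power-series group laws respect congruence modulo `p^n`.**
Let `c` assign to each pair of multi-indices `(I, J)` a vector in `ℤ_p^d`, with norms
tending to zero (only finitely many pairs have `‖c (I,J)‖ ≥ r` for each `r > 0`) and with
`c (I, J) = 0` whenever `|I| = 0` or `|J| = 0`.  Define
`x ⋆ y = x + y + ∑'_{(I,J)} (x^I y^J) • c (I,J)`.  Then for every `n`, congruence of all
coordinates modulo `p^n` is respected by `⋆`. -/
theorem stmt11 (p : ℕ) [Fact p.Prime] (d : ℕ) (hd : 1 ≤ d)
    (c : ((Fin d → ℕ) × (Fin d → ℕ)) → (Fin d → ℤ_[p]))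
    (hfin : ∀ r : ℝ, 0 < r → {IJ : (Fin d → ℕ) × (Fin d → ℕ) | r ≤ ‖c IJ‖}.Finite)
    (hzero : ∀ IJ : (Fin d → ℕ) × (Fin d → ℕ),
      ((∑ j, IJ.1 j) = 0 ∨ (∑ j, IJ.2 j) = 0) → c IJ = 0)
    (star : (Fin d → ℤ_[p]) → (Fin d → ℤ_[p]) → (Fin d → ℤ_[p]))
    (hstar : ∀ x y : Fin d → ℤ_[p], star x y = x + y +
      ∑' IJ : (Fin d → ℕ) × (Fin d → ℕ),
        ((∏ j, x j ^ IJ.1 j) * (∏ j, y j ^ IJ.2 j)) • c IJ) :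
    ∀ n : ℕ, ∀ x x' y y' : Fin d → ℤ_[p],
      (∀ i, (p : ℤ_[p]) ^ n ∣ (x i - x' i)) →
      (∀ i, (p : ℤ_[p]) ^ n ∣ (y i - y' i)) →
      ∀ i, (p : ℤ_[p]) ^ n ∣ (star x y i - star x' y' i) := by
  intro n x x' y y' hx hy i
  have hs := fun (x y : Fin d → ℤ_[p]) => summable_mul_apply_of_finite_norm_ge hfin
    fun IJ => (∏ j, x j ^ IJ.1 j) * ∏ j, y j ^ IJ.2 j
  have hstar_apply : ∀ x y : Fin d → ℤ_[p], star x y i = x i + y i +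
      ∑' IJ, ((∏ j, x j ^ IJ.1 j) * ∏ j, y j ^ IJ.2 j) * c IJ i := by
    intro x y
    rw [hstar, Pi.add_apply, Pi.add_apply]
    exact congrArg _ (tsum_apply (Pi.summable.mpr (hs x y)))
  rw [hstar_apply, hstar_apply, add_sub_add_comm, add_sub_add_comm,
    ← (hs x y i).tsum_sub (hs x' y' i)]
  refine dvd_add (dvd_add (hx i) (hy i)) (PadicInt.pow_dvd_tsum n fun IJ => ?_)
  rw [← sub_mul]
  exact (dvd_mul_sub_mul (dvd_prod_pow_sub_prod_pow hx IJ.1)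
    (dvd_prod_pow_sub_prod_pow hy IJ.2)).mul_right _
end

section
/- Let p be a prime and d ≥ 1. Let c : (Fin d → ℕ) × (Fin d → ℕ) → (Fin d → ℤ_p) be such that for every real r > 0 only finitely many pairs (I, J) satisfy ‖c (I, J)‖ ≥ r, such that c (I, J) = 0 whenever |I| = 0 or |J| = 0, and such that every coordinate of c (I, J) lies in p^{|I|+|J|-1} ℤ_p. Define x ⋆ y = x + y + ∑'_{(I,J)} (x^I · y^J) • c (I, J). Then for every n ≥ 1 and all x, y ∈ (Fin d → ℤ_p), the difference (x ⋆ y) - (x + y + ∑_{(I,J) : |I| ≥ 1, |J| ≥ 1, |I|+|J| ≤ n} (x^I · y^J) • c (I, J)) has all coordinates in p^n ℤ_p; in particular x ⋆ y ≡ x + y modulo p (Fin d → ℤ_p). -/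
open Filter Topology

/-- A family of vectors over `ℤ_p` is summable as soon as it is dominated in norm by a family
all of whose superlevel sets at positive levels are finite. -/
theorem PadicInt.summable_of_norm_le_of_finite {p : ℕ} [Fact p.Prime] {κ ι : Type*} [Fintype κ]
    {c f : ι → (κ → ℤ_[p])} (hfin : ∀ r : ℝ, 0 < r → {a | r ≤ ‖c a‖}.Finite)
    (hf : ∀ a, ‖f a‖ ≤ ‖c a‖) : Summable f := by
  apply NonarchimedeanAddGroup.summable_of_tendsto_cofinite_zero
  rw [Metric.tendsto_nhds]
  intro ε hε
  rw [Filter.eventually_cofinite]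
  refine (hfin ε hε).subset fun a ha => ?_
  simp only [Set.mem_ofPred_eq, dist_zero_right, not_lt] at ha ⊢
  exact ha.trans (hf a)

/-- Divisibility by `p ^ n` in a fixed coordinate passes to infinite sums over `ℤ_p`. -/
theorem PadicInt.pow_dvd_tsum_apply {p : ℕ} [Fact p.Prime] {κ ι : Type*} [Fintype κ]
    {f : ι → (κ → ℤ_[p])} (hs : Summable f) {n : ℕ} {i : κ}
    (hf : ∀ a, (p : ℤ_[p]) ^ n ∣ f a i) : (p : ℤ_[p]) ^ n ∣ (∑' a, f a) i := by
  have key (z : ℤ_[p]) : (p : ℤ_[p]) ^ n ∣ z ↔ ‖z‖ ≤ (p : ℝ) ^ (-n : ℤ) := by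
    rw [PadicInt.norm_le_pow_iff_mem_span_pow, Ideal.mem_span_singleton]
  simp only [key] at hf ⊢
  rw [tsum_apply hs]
  exact IsUltrametricDist.norm_tsum_le_of_forall_le_of_nonneg (by positivity) hf

/-- **Truncations of a power-series group law modulo `p^n`.**
Let `c` assign to each pair of multi-indices `(I, J)` a vector in `ℤ_p^d`, with norms
tending to zero, with `c (I, J) = 0` whenever `|I| = 0` or `|J| = 0`, and with every
coordinate of `c (I, J)` divisible by `p^(|I|+|J|-1)`.  Define
`x ⋆ y = x + y + ∑'_{(I,J)} (x^I y^J) • c (I,J)`.  Then for every `n ≥ 1`, `x ⋆ y` agrees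
with its Taylor truncation `x + y + ∑_{1 ≤ |I|, 1 ≤ |J|, |I|+|J| ≤ n} (x^I y^J) • c (I,J)`
modulo `p^n` in every coordinate; in particular `x ⋆ y ≡ x + y (mod p)`. -/
theorem stmt12 (p : ℕ) [Fact p.Prime] (d : ℕ) (hd : 1 ≤ d)
    (c : ((Fin d → ℕ) × (Fin d → ℕ)) → (Fin d → ℤ_[p]))
    (hfin : ∀ r : ℝ, 0 < r → {IJ : (Fin d → ℕ) × (Fin d → ℕ) | r ≤ ‖c IJ‖}.Finite)
    (hzero : ∀ IJ : (Fin d → ℕ) × (Fin d → ℕ),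
      ((∑ j, IJ.1 j) = 0 ∨ (∑ j, IJ.2 j) = 0) → c IJ = 0)
    (hcoef : ∀ IJ : (Fin d → ℕ) × (Fin d → ℕ), ∀ i : Fin d,
      (p : ℤ_[p]) ^ ((∑ j, IJ.1 j) + (∑ j, IJ.2 j) - 1) ∣ c IJ i)
    (star : (Fin d → ℤ_[p]) → (Fin d → ℤ_[p]) → (Fin d → ℤ_[p]))
    (hstar : ∀ x y : Fin d → ℤ_[p], star x y = x + y +
      ∑' IJ : (Fin d → ℕ) × (Fin d → ℕ),
        ((∏ j, x j ^ IJ.1 j) * (∏ j, y j ^ IJ.2 j)) • c IJ) :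
    (∀ n : ℕ, 1 ≤ n → ∀ x y : Fin d → ℤ_[p], ∀ i : Fin d,
      (p : ℤ_[p]) ^ n ∣
        (star x y - (x + y +
          ∑' IJ : (Fin d → ℕ) × (Fin d → ℕ),
            if 1 ≤ (∑ j, IJ.1 j) ∧ 1 ≤ (∑ j, IJ.2 j) ∧ (∑ j, IJ.1 j) + (∑ j, IJ.2 j) ≤ n
            then ((∏ j, x j ^ IJ.1 j) * (∏ j, y j ^ IJ.2 j)) • c IJ
            else 0)) i) ∧
    (∀ x y : Fin d → ℤ_[p], ∀ i : Fin d, (p : ℤ_[p]) ∣ (star x y - (x + y)) i) := by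
  have hnorm (x y : Fin d → ℤ_[p]) (IJ : (Fin d → ℕ) × (Fin d → ℕ)) :
      ‖((∏ j, x j ^ IJ.1 j) * (∏ j, y j ^ IJ.2 j)) • c IJ‖ ≤ ‖c IJ‖ :=
    (norm_smul_le _ _).trans (mul_le_of_le_one_left (norm_nonneg _) (PadicInt.norm_le_one _))
  have main : ∀ n : ℕ, 1 ≤ n → ∀ x y : Fin d → ℤ_[p], ∀ i : Fin d,
      (p : ℤ_[p]) ^ n ∣
        (star x y - (x + y +
          ∑' IJ : (Fin d → ℕ) × (Fin d → ℕ),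
            if 1 ≤ (∑ j, IJ.1 j) ∧ 1 ≤ (∑ j, IJ.2 j) ∧ (∑ j, IJ.1 j) + (∑ j, IJ.2 j) ≤ n
            then ((∏ j, x j ^ IJ.1 j) * (∏ j, y j ^ IJ.2 j)) • c IJ
            else 0)) i := by
    intro n _ x y i
    have hs := PadicInt.summable_of_norm_le_of_finite hfin (hnorm x y)
    have ht : Summable fun IJ : (Fin d → ℕ) × (Fin d → ℕ) =>
        if 1 ≤ (∑ j, IJ.1 j) ∧ 1 ≤ (∑ j, IJ.2 j) ∧ (∑ j, IJ.1 j) + (∑ j, IJ.2 j) ≤ n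
        then ((∏ j, x j ^ IJ.1 j) * (∏ j, y j ^ IJ.2 j)) • c IJ else 0 := by
      refine PadicInt.summable_of_norm_le_of_finite hfin fun IJ => ?_
      split_ifs
      · exact hnorm x y IJ
      · simp
    rw [hstar, add_sub_add_left_eq_sub, ← hs.tsum_sub ht]
    refine PadicInt.pow_dvd_tsum_apply (hs.sub ht) fun IJ => ?_
    split_ifs with h
    · simp
    · rw [sub_zero, Pi.smul_apply, smul_eq_mul]
      apply Dvd.dvd.mul_left
      by_cases h0 : (∑ j, IJ.1 j) = 0 ∨ (∑ j, IJ.2 j) = 0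
      · simp [hzero IJ h0]
      · exact (pow_dvd_pow _ (by omega)).trans (hcoef IJ i)
  refine ⟨main, fun x y i => ?_⟩
  have hempty (a b : ℕ) : ¬ (1 ≤ a ∧ 1 ≤ b ∧ a + b ≤ 1) := by omega
  simpa only [hempty, if_false, tsum_zero, add_zero, pow_one] using main 1 le_rfl x y i
end

section
/- Let p be a prime and d ≥ 1. Suppose the set Fin d → ℤ_p is endowed with a group operation ⋆ whose identity element is 0, and let f x = x^p denote the p-fold ⋆-power. Assume ‖f x - f y‖ = p^{-1} · ‖x - y‖ for all x, y, and assume the image of f contains the ball {y : ‖y‖ ≤ p^{-1}}. Then for every i ∈ ℕ the image under f of the ball {x : ‖x‖ ≤ p^{-i}} equals the ball {y : ‖y‖ ≤ p^{-(i+1)}}, and the image of the p^i-th ⋆-power map x ↦ x^{p^i} equals the ball {y : ‖y‖ ≤ p^{-i}}. -/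
open Filter Topology

/-- **Images of balls under iterated `p`-th power maps.**
If `⋆` is a group operation on `ℤ_p^d` with identity `0`, `gpow x k` denotes the `k`-fold
`⋆`-power of `x`, the `p`-th power map `f x = gpow x p` satisfies
`‖f x - f y‖ = p⁻¹ ‖x - y‖` (sup norm), and the image of `f` contains the ball of radius
`p⁻¹`, then for every `i` the image under `f` of the ball of radius `p⁻ⁱ` is the ball of
radius `p⁻⁽ⁱ⁺¹⁾`, and the image of the `pⁱ`-th power map is the ball of radius `p⁻ⁱ`. -/
theorem stmt14 (p : ℕ) [Fact p.Prime] (d : ℕ) (hd : 1 ≤ d)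
    (star : (Fin d → ℤ_[p]) → (Fin d → ℤ_[p]) → (Fin d → ℤ_[p]))
    (hassoc : ∀ x y z : Fin d → ℤ_[p], star (star x y) z = star x (star y z))
    (hidl : ∀ x : Fin d → ℤ_[p], star 0 x = x)
    (hidr : ∀ x : Fin d → ℤ_[p], star x 0 = x)
    (hinv : ∀ x : Fin d → ℤ_[p], ∃ y : Fin d → ℤ_[p], star x y = 0 ∧ star y x = 0)
    (gpow : (Fin d → ℤ_[p]) → ℕ → (Fin d → ℤ_[p]))
    (hgpow0 : ∀ x : Fin d → ℤ_[p], gpow x 0 = 0)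
    (hgpowS : ∀ x : Fin d → ℤ_[p], ∀ k : ℕ, gpow x (k + 1) = star x (gpow x k))
    (hscale : ∀ x y : Fin d → ℤ_[p], ‖gpow x p - gpow y p‖ = (p : ℝ)⁻¹ * ‖x - y‖)
    (himg : {y : Fin d → ℤ_[p] | ‖y‖ ≤ (p : ℝ)⁻¹} ⊆ Set.range (fun x => gpow x p)) :
    ∀ i : ℕ,
      ((fun x => gpow x p) '' {x : Fin d → ℤ_[p] | ‖x‖ ≤ (p : ℝ) ^ (-(i : ℤ))} =
        {y : Fin d → ℤ_[p] | ‖y‖ ≤ (p : ℝ) ^ (-(i : ℤ) - 1)}) ∧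
      (Set.range (fun x => gpow x (p ^ i)) =
        {y : Fin d → ℤ_[p] | ‖y‖ ≤ (p : ℝ) ^ (-(i : ℤ))}) := by
  have hp : (0 : ℝ) < p := by exact_mod_cast (Fact.out : p.Prime).pos
  have hp1 : (1 : ℝ) ≤ p := by exact_mod_cast (Fact.out : p.Prime).one_le
  have gpow_zero_left (k : ℕ) : gpow 0 k = 0 := by
    induction k with
    | zero => exact hgpow0 0
    | succ k ih => rw [hgpowS, ih, hidl]
  have gpow_add (x : Fin d → ℤ_[p]) (m n : ℕ) :
      gpow x (m + n) = star (gpow x m) (gpow x n) := by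
    induction m with
    | zero => rw [Nat.zero_add, hgpow0, hidl]
    | succ m ih => rw [Nat.add_right_comm, hgpowS, ih, hgpowS, hassoc]
  have gpow_mul (x : Fin d → ℤ_[p]) (m n : ℕ) : gpow x (m * n) = gpow (gpow x m) n := by
    induction n with
    | zero => rw [Nat.mul_zero, hgpow0, hgpow0]
    | succ n ih => rw [Nat.mul_succ, Nat.add_comm, gpow_add, ih, hgpowS]
  have norm_gpow (x : Fin d → ℤ_[p]) : ‖gpow x p‖ = (p : ℝ)⁻¹ * ‖x‖ := by
    simpa [gpow_zero_left] using hscale x 0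
  have norm_gpow_le_iff (i : ℕ) (x : Fin d → ℤ_[p]) :
      ‖gpow x p‖ ≤ (p : ℝ) ^ (-(i : ℤ) - 1) ↔ ‖x‖ ≤ (p : ℝ) ^ (-(i : ℤ)) := by
    rw [norm_gpow, zpow_sub_one₀ hp.ne', mul_comm]
    exact mul_le_mul_iff_left₀ (inv_pos.2 hp)
  have image_ball (i : ℕ) :
      (fun x => gpow x p) '' {x : Fin d → ℤ_[p] | ‖x‖ ≤ (p : ℝ) ^ (-(i : ℤ))} =
        {y : Fin d → ℤ_[p] | ‖y‖ ≤ (p : ℝ) ^ (-(i : ℤ) - 1)} := by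
    refine Set.Subset.antisymm (Set.image_subset_iff.2 fun x hx => (norm_gpow_le_iff i x).2 hx) ?_
    intro y hy
    have hle : (p : ℝ) ^ (-(i : ℤ) - 1) ≤ (p : ℝ)⁻¹ := by
      rw [← zpow_neg_one]
      exact zpow_le_zpow_right₀ hp1 (by lia)
    obtain ⟨x, rfl⟩ := himg (le_trans hy hle)
    exact ⟨x, (norm_gpow_le_iff i x).1 hy, rfl⟩
  refine fun i => ⟨image_ball i, ?_⟩
  induction i with
  | zero =>
    ext y
    have hy : ‖y‖ ≤ 1 := (pi_norm_le_iff_of_nonneg zero_le_one).2 fun j => PadicInt.norm_le_one _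
    have hy' : gpow y 1 = y := by rw [← Nat.zero_add 1, hgpowS, hgpow0, hidr]
    simpa [hy] using ⟨y, hy'⟩
  | succ i ih =>
    have hcomp : (fun x => gpow x (p ^ (i + 1))) =
        (fun x => gpow x p) ∘ fun x => gpow x (p ^ i) := by
      funext x
      rw [pow_succ, gpow_mul, Function.comp_apply]
    have hexp : -((i + 1 : ℕ) : ℤ) = -(i : ℤ) - 1 := by lia
    rw [hcomp, Set.range_comp, ih, image_ball, hexp]
end
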